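/- arXiv:1411.4819 — 2 statements merged into one kernel-verified Lean document; each statement's English description precedes it below -/
import Mathlib

section
/- Every 3-connected graph on n vertices contains at least n³/32 − n²/16 distinct K4-subdivisions. -/
open SimpleGraph

variable {V : Type*}

/-- A graph is `k`-connected if it has more than `k` vertices and no set of fewer than `k`
vertices whose deletion leaves a disconnected graph. -/
def IsKConnected [Fintype V] (k : ℕ) (G : SimpleGraph V) : Prop :=
  k < Fintype.card V ∧
    ∀ S : Finset V, S.card < k → (G.induce ((↑S : Set V)ᶜ)).Connected

/-- `H` is a `K₄`-subdivision of `G` with branch ("real") vertices `b 0, b 1, b 2, b 3`: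
there are six paths of length at least one in `G`, one between each pair of branch
vertices, whose union is `H`, such that any two of these paths intersect exactly in
their common endpoints (in particular they are internally disjoint from each other and
from the branch vertices). -/
def IsK4SubdivisionOn {G : SimpleGraph V} (H : G.Subgraph) (b : Fin 4 → V) : Prop :=
  Function.Injective b ∧
  ∃ P : ∀ p : Fin 4 × Fin 4, p.1 < p.2 → G.Walk (b p.1) (b p.2),
    (∀ p h, (P p h).IsPath) ∧
    (∀ p h, 0 < (P p h).length) ∧
    (H = ⨆ (p : Fin 4 × Fin 4) (h : p.1 < p.2), (P p h).toSubgraph) ∧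
    (∀ p q hp hq, p ≠ q → ∀ x, x ∈ (P p hp).support → x ∈ (P q hq).support →
      x ∈ ({b p.1, b p.2} ∩ {b q.1, b q.2} : Set V))

/-- `H` is a subgraph of `G` that is a `K₄`-subdivision. -/
def IsK4Subdivision {G : SimpleGraph V} (H : G.Subgraph) : Prop :=
  ∃ b, IsK4SubdivisionOn H b

section Menger

variable {H : SimpleGraph V}

/-- A sequence of vertices in which consecutive terms are adjacent and which has no repetition
up to time `n` yields a path. -/
theorem exists_isPath_of_seq (g : ℕ → V) (n : ℕ) (hadj : ∀ m < n, H.Adj (g m) (g (m + 1)))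
    (hinj : ∀ a ≤ n, ∀ b ≤ n, g a = g b → a = b) :
    ∃ p : H.Walk (g 0) (g n), p.IsPath ∧ ∀ x, x ∈ p.support ↔ ∃ m ≤ n, g m = x := by
  induction n with
  | zero => exact ⟨.nil, by simp, by simp [eq_comm]⟩
  | succ n ih =>
    obtain ⟨p, hp, hs⟩ := ih (fun m hm => hadj m (by omega))
      (fun a ha b hb => hinj a (by omega) b (by omega))
    refine ⟨p.concat (hadj n (by omega)), ?_, ?_⟩
    · rw [Walk.concat_isPath_iff]
      refine ⟨hp, ?_⟩
      rw [hs]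
      rintro ⟨m, hm, h⟩
      have := hinj m (by omega) _ le_rfl h
      omega
    · intro x
      simp only [Walk.support_concat, List.mem_append, hs,
        List.mem_singleton]
      constructor
      · rintro (⟨m, hm, rfl⟩ | rfl)
        · exact ⟨m, by omega, rfl⟩
        · exact ⟨n + 1, le_rfl, rfl⟩
      · rintro ⟨m, hm, rfl⟩
        rcases Nat.lt_or_ge n m with h | h
        · exact Or.inr (by rw [show m = n + 1 by omega])
        · exact Or.inl ⟨m, h, rfl⟩

/-- **Menger's theorem**: if no set of fewer than `k` vertices separates `T` from `B`, there are
`k` disjoint paths from `T` to `B` which meet `B` only in their last vertex. -/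
theorem exists_disjoint_paths [Finite V] (T B : Set V) (k : ℕ)
    (h : ∀ S : Finset V, S.card < k →
      ∃ t ∈ T, ∃ c ∈ B, ∃ p : H.Walk t c, ∀ x ∈ p.support, x ∉ S) :
    ∃ (s t : Fin k → V) (p : ∀ i, H.Walk (s i) (t i)), (∀ i, (p i).IsPath) ∧
      (∀ i, s i ∈ T) ∧ (∀ i, t i ∈ B) ∧ (∀ i, ∀ x ∈ (p i).support, x ∈ B → x = t i) ∧
      ∀ i j x, x ∈ (p i).support → x ∈ (p j).support → i = j := by
  classical
  cases nonempty_fintype V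
  let nb : Fin k ⊕ {x // x ∉ B} → Finset V :=
    Sum.elim (fun _ => T.toFinset) (fun x => insert x.1 (H.neighborFinset x.1))
  have hall : ∀ X : Finset (Fin k ⊕ {x // x ∉ B}), X.card ≤ (X.biUnion nb).card := by
    intro X
    by_contra! hlt
    set X₀ : Finset V := X.toRight.map (Function.Embedding.subtype _) with hX₀
    have hXB : ∀ x ∈ X₀, x ∉ B := by
      intro x hx
      simp only [hX₀, Finset.mem_map] at hx
      obtain ⟨y, -, rfl⟩ := hx
      exact y.2
    have hmem : ∀ x (hx : x ∈ X₀), Sum.inr ⟨x, hXB x hx⟩ ∈ X := by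
      intro x hx
      simp only [hX₀, Finset.mem_map] at hx
      obtain ⟨y, hy, rfl⟩ := hx
      simpa using hy
    have hcard : X.card = X.toLeft.card + X₀.card := by
      rw [hX₀, Finset.card_map, Finset.card_toLeft_add_card_toRight]
    have hsub : X₀ ⊆ X.biUnion nb := by
      intro x hx
      exact Finset.mem_biUnion.2 ⟨_, hmem x hx, by simp [nb]⟩
    have hle : X.toLeft.card ≤ k := by simpa using Finset.card_le_univ X.toLeft
    have hsd : (X.biUnion nb \ X₀).card + X₀.card = (X.biUnion nb).card :=
      Finset.card_sdiff_add_card_eq_card hsub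
    obtain ⟨i, hi⟩ : X.toLeft.Nonempty := by
      rw [← Finset.card_pos]; omega
    obtain ⟨t, ht, c, hc, p, hp⟩ := h (X.biUnion nb \ X₀) (by omega)
    have htX : t ∈ X₀ := by
      by_contra htX
      exact hp t p.start_mem_support (Finset.mem_sdiff.2 ⟨Finset.mem_biUnion.2
        ⟨_, Finset.mem_toLeft.1 hi, by simpa [nb] using ht⟩, htX⟩)
    obtain ⟨d, hd, hd1, hd2⟩ := p.exists_boundary_dart (X₀ : Set V) htX (fun hcX => hXB c hcX hc)
    refine hp _ (p.dart_snd_mem_support_of_mem_darts hd) (Finset.mem_sdiff.2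
      ⟨Finset.mem_biUnion.2 ⟨_, hmem _ hd1, ?_⟩, hd2⟩)
    simp [nb, d.adj]
  obtain ⟨f, hf, hfn⟩ := (Finset.all_card_le_biUnion_card_iff_exists_injective nb).1 hall
  let g : Fin k → ℕ → V := fun i n => Nat.rec (f (Sum.inl i))
    (fun _ x => if hx : x ∈ B then x else f (Sum.inr ⟨x, hx⟩)) n
  have g0 : ∀ i, g i 0 = f (Sum.inl i) := fun i => rfl
  have gs : ∀ i n (hx : g i n ∉ B), g i (n + 1) = f (Sum.inr ⟨g i n, hx⟩) := fun i n hx =>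
    dif_neg hx
  have ginj : ∀ i j a b, (∀ m < a, g i m ∉ B) → (∀ m < b, g j m ∉ B) → g i a = g j b →
      i = j ∧ a = b := by
    intro i j a
    induction a with
    | zero =>
      intro b _ hb hab
      cases b with
      | zero => exact ⟨by simpa using hf hab, rfl⟩
      | succ b =>
        rw [g0, gs j b (hb b (by omega))] at hab
        simpa using hf hab
    | succ a ih =>
      intro b ha hb hab
      rw [gs i a (ha a (by omega))] at hab
      cases b with
      | zero => simpa using hf hab
      | succ b =>
        rw [gs j b (hb b (by omega))] at hab
        have := ih b (fun m hm => ha m (by omega)) (fun m hm => hb m (by omega))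
          (by simpa using hf hab)
        exact ⟨this.1, by omega⟩
  have hex : ∀ i, ∃ n, g i n ∈ B := by
    intro i
    by_contra! hno
    exact not_injective_infinite_finite (g i)
      (fun a b hab => (ginj i i a b (fun m _ => hno m) (fun m _ => hno m) hab).2)
  have hmin : ∀ i, ∀ m < Nat.find (hex i), g i m ∉ B := fun i m hm => Nat.find_min (hex i) hm
  have hpath : ∀ i, ∃ p : H.Walk (g i 0) (g i (Nat.find (hex i))), p.IsPath ∧
      ∀ x, x ∈ p.support ↔ ∃ m ≤ Nat.find (hex i), g i m = x := by
    intro i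
    apply exists_isPath_of_seq
    · intro m hm
      have hmB := hmin i m hm
      have h1 := hfn (Sum.inr ⟨g i m, hmB⟩)
      rw [← gs i m hmB] at h1
      simp only [nb, Sum.elim_inr, Finset.mem_insert, mem_neighborFinset] at h1
      rcases h1 with h1 | h1
      · have := (ginj i i (m + 1) m (fun n hn => hmin i n (by omega))
          (fun n hn => hmin i n (by omega)) h1).2
        omega
      · exact h1
    · intro a ha b hb hab
      exact (ginj i i a b (fun n hn => hmin i n (by omega))
          (fun n hn => hmin i n (by omega)) hab).2
  choose p hp hs using hpath
  refine ⟨_, _, p, hp, ?_, fun i => Nat.find_spec (hex i), ?_, ?_⟩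
  · intro i
    simpa [nb, g0] using hfn (Sum.inl i)
  · intro i x hx hxB
    obtain ⟨m, hm, rfl⟩ := (hs i x).1 hx
    rcases hm.lt_or_eq with h1 | h1
    · exact absurd hxB (hmin i m h1)
    · rw [h1]
  · intro i j x hx hy
    obtain ⟨m, hm, rfl⟩ := (hs i x).1 hx
    obtain ⟨n, hn, hmn⟩ := (hs j _).1 hy
    exact ((ginj j i n m (fun l hl => hmin j l (by omega))
      (fun l hl => hmin i l (by omega)) hmn).1).symm

end Menger

section Ear

/-- The edge sets of the cycles of a graph. -/
def cycleEdgeSets (H : SimpleGraph V) : Set (Set (Sym2 V)) :=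
  {C | ∃ u, ∃ p : H.Walk u u, p.IsCycle ∧ C = p.edgeSet}

/-- A graph without a cut vertex, isolated vertices being ignored. -/
def HasNoCutVertex (H : SimpleGraph V) : Prop :=
  ∀ x a b, a ∈ H.support → b ∈ H.support → a ≠ x → b ≠ x → ∃ p : H.Walk a b, x ∉ p.support

/-- `K'` arises from `K` by adding a path with distinct ends in `K` and otherwise disjoint
from `K`. -/
def IsEar (K K' : SimpleGraph V) : Prop :=
  K ≤ K' ∧ ∃ (x y w : V) (h : K'.Adj x y) (q : K'.Walk y w), q.IsPath ∧ x ∉ q.support ∧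
    x ∈ K.support ∧ w ∈ K.support ∧ ¬ K.Adj x y ∧ (∀ z ∈ q.support, z ∈ K.support → z = w) ∧
    K'.edgeSet = K.edgeSet ∪ (Walk.cons h q).edgeSet

theorem cycleEdgeSets_mono {K H : SimpleGraph V} (h : K ≤ H) :
    cycleEdgeSets K ⊆ cycleEdgeSets H := by
  rintro C ⟨u, p, hp, rfl⟩
  exact ⟨u, p.mapLe h, hp.mapLe h, by simp⟩

theorem subset_edgeSet_of_mem_cycleEdgeSets {H : SimpleGraph V} {C : Set (Sym2 V)}
    (hC : C ∈ cycleEdgeSets H) : C ⊆ H.edgeSet := by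
  obtain ⟨u, p, -, rfl⟩ := hC
  exact fun e he => p.edges_subset_edgeSet he

/-- A walk ending in `B` can be cut to a path ending at its first vertex in `B`. -/
theorem exists_isPath_first_mem {H : SimpleGraph V} (B : Set V) {y z : V} (p : H.Walk y z)
    (hz : z ∈ B) : ∃ w ∈ B, ∃ q : H.Walk y w, q.IsPath ∧ (∀ v ∈ q.support, v ∈ p.support) ∧
      ∀ v ∈ q.support, v ∈ B → v = w := by
  classical
  suffices ∃ w ∈ B, ∃ q : H.Walk y w, (∀ v ∈ q.support, v ∈ p.support) ∧
      ∀ v ∈ q.support, v ∈ B → v = w by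
    obtain ⟨w, hw, q, h1, h2⟩ := this
    exact ⟨w, hw, q.bypass, q.bypass_isPath,
      fun v hv => h1 v (q.support_bypass_subset_support hv),
      fun v hv => h2 v (q.support_bypass_subset_support hv)⟩
  induction p with
  | nil => exact ⟨_, hz, .nil, by simp, by simp⟩
  | @cons a b c h p ih =>
    by_cases ha : a ∈ B
    · exact ⟨a, ha, .nil, by simp, by simp⟩
    · obtain ⟨w, hw, q, h1, h2⟩ := ih hz
      refine ⟨w, hw, .cons h q, ?_, ?_⟩
      · simp only [Walk.support_cons, List.mem_cons]
        grind
      · simp only [Walk.support_cons, List.mem_cons]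
        grind

theorem exists_isEar {K H : SimpleGraph V} (hH : HasNoCutVertex H) (hKH : K ≤ H) (hne : K ≠ H)
    (hK : K.support.Nonempty) : ∃ K' ≤ H, IsEar K K' := by
  have hsup : K.support ⊆ H.support := SimpleGraph.support_mono hKH
  obtain ⟨x, y, hx, hxy, hnxy⟩ : ∃ x y, x ∈ K.support ∧ H.Adj x y ∧ ¬ K.Adj x y := by
    obtain ⟨c, d, hcd, hncd⟩ : ∃ c d, H.Adj c d ∧ ¬ K.Adj c d := by
      by_contra! hcon
      exact hne (le_antisymm hKH (fun c d h => hcon c d h))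
    by_cases hc : c ∈ K.support
    · exact ⟨c, d, hc, hcd, hncd⟩
    by_cases hd : d ∈ K.support
    · exact ⟨d, c, hd, hcd.symm, fun h => hncd h.symm⟩
    obtain ⟨a, ha⟩ := hK
    obtain ⟨p, -⟩ := hH d a c (hsup ha) ⟨d, hcd⟩ (fun h => hd (h ▸ ha)) hcd.ne
    obtain ⟨e, -, he1, he2⟩ := p.exists_boundary_dart K.support ha hc
    exact ⟨e.fst, e.snd, he1, e.adj, fun h => he2 ⟨_, h.symm⟩⟩
  obtain ⟨z, hz⟩ := id hx
  obtain ⟨p, hp⟩ := hH x y z ⟨x, hxy.symm⟩ (hsup ⟨x, hz.symm⟩) hxy.ne' hz.ne'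
  obtain ⟨w, hw, q, hq, hqs, hqB⟩ := exists_isPath_first_mem K.support p ⟨x, hz.symm⟩
  set K' := SimpleGraph.fromEdgeSet (K.edgeSet ∪ (Walk.cons hxy q).edgeSet) with hK'
  have hE : K'.edgeSet = K.edgeSet ∪ (Walk.cons hxy q).edgeSet := by
    rw [hK', edgeSet_fromEdgeSet, sdiff_eq_left, Set.disjoint_left]
    rintro e (he | he) hd
    · exact K.not_isDiag_of_mem_edgeSet he hd
    · exact H.not_isDiag_of_mem_edgeSet ((Walk.cons hxy q).edges_subset_edgeSet he) hd
  have hxyK' : K'.Adj x y := by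
    rw [← mem_edgeSet, hE]
    simp
  have hqK' : ∀ e ∈ q.edges, e ∈ K'.edgeSet := by
    intro e he
    rw [hE]
    simp [he]
  refine ⟨K', ?_, ?_, x, y, w, hxyK', q.transfer K' hqK', hq.transfer _, ?_, hx, hw, hnxy, ?_, ?_⟩
  · rw [← edgeSet_subset_edgeSet, hE]
    exact Set.union_subset (edgeSet_subset_edgeSet.2 hKH)
      (fun e he => (Walk.cons hxy q).edges_subset_edgeSet he)
  · rw [← edgeSet_subset_edgeSet, hE]
    exact Set.subset_union_left
  · simpa using fun h => hp (hqs _ h)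
  · simpa using hqB
  · rw [hE]; simp

theorem IsEar.support_eq {K K' : SimpleGraph V} (hle : K ≤ K') {x y w : V} (h : K'.Adj x y)
    (q : K'.Walk y w) (hx : x ∈ K.support)
    (hE : K'.edgeSet = K.edgeSet ∪ (Walk.cons h q).edgeSet) :
    K'.support = K.support ∪ {z | z ∈ q.support} := by
  ext a
  constructor
  · rintro ⟨b, hab : K'.Adj a b⟩
    rw [← mem_edgeSet, hE] at hab
    rcases hab with hab | hab
    · exact Or.inl ⟨b, hab⟩
    · have := (Walk.cons h q).fst_mem_support_of_mem_edges hab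
      rw [Walk.support_cons, List.mem_cons] at this
      rcases this with rfl | h1
      · exact Or.inl hx
      · exact Or.inr h1
  · rintro (ha | ha)
    · exact SimpleGraph.support_mono hle ha
    · have : a ∈ (Walk.cons h q).support := by simp at ha; simp [ha]
      rw [Walk.mem_support_iff_exists_mem_edges_of_not_nil (by simp)] at this
      obtain ⟨e, he, hae⟩ := this
      obtain ⟨b, rfl⟩ := hae
      exact ⟨b, (Walk.cons h q).adj_of_mem_edges he⟩

theorem IsEar.hasNoCutVertex {K K' : SimpleGraph V} (hKK' : IsEar K K') (hK : HasNoCutVertex K) :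
    HasNoCutVertex K' := by
  obtain ⟨hle, x, y, w, h, q, hq, hxq, hx, hw, -, -, hE⟩ := hKK'
  have key : ∀ z a, a ∈ K'.support → a ≠ z →
      ∃ c ∈ K.support, c ≠ z ∧ ∃ p : K'.Walk a c, z ∉ p.support := by
    intro z a ha haz
    rw [IsEar.support_eq hle h q hx hE] at ha
    rcases ha with ha | ha
    · exact ⟨a, ha, haz, .nil, by simpa using haz.symm⟩
    obtain ⟨r, s, rfl⟩ := q.mem_support_iff_exists_append.1 ha
    by_cases hz : z ∈ s.support
    · refine ⟨x, hx, fun hxz => hxq ?_, r.reverse.concat h.symm, ?_⟩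
      · rw [hxz, Walk.mem_support_append_iff]; exact Or.inr hz
      · simp only [Walk.support_concat, Walk.support_reverse, List.mem_append,
          List.mem_reverse, List.mem_singleton, not_or]
        constructor
        · intro hzr
          rw [Walk.isPath_def, Walk.support_append] at hq
          have hz' : z ∈ s.support.tail := by
            simpa [haz.symm] using s.mem_support_iff.1 hz
          exact List.disjoint_of_nodup_append hq hzr hz'
        · rintro rfl
          exact hxq (by rw [Walk.mem_support_append_iff]; exact Or.inr hz)
    · exact ⟨w, hw, fun hwz => hz (hwz ▸ s.end_mem_support), s, hz⟩
  intro z a b ha hb haz hbz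
  obtain ⟨c, hc, hcz, p, hp⟩ := key z a ha haz
  obtain ⟨d, hd, hdz, r, hr⟩ := key z b hb hbz
  obtain ⟨s, hs⟩ := hK z c d hc hd hcz hdz
  refine ⟨p.append ((s.mapLe hle).append r.reverse), ?_⟩
  simp [Walk.mem_support_append_iff, hp, hr, hs]

theorem IsEar.edges_disjoint {K K' : SimpleGraph V} {x y w : V} (h : K'.Adj x y)
    (q : K'.Walk y w) (hxy : ¬ K.Adj x y) (hqK : ∀ z ∈ q.support, z ∈ K.support → z = w) :
    Disjoint K.edgeSet (Walk.cons h q).edgeSet := by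
  rw [Set.disjoint_left]
  intro e heK he
  rw [Walk.edgeSet_cons, Set.mem_insert_iff] at he
  rcases he with rfl | he
  · exact hxy heK
  · induction e with
    | _ a b =>
      have h1 := hqK a (q.fst_mem_support_of_mem_edges he) ⟨b, heK⟩
      have h2 := hqK b (q.snd_mem_support_of_mem_edges he) ⟨a, heK.symm⟩
      exact K.ne_of_adj heK (h1.trans h2.symm)

theorem ncard_edgeSet_of_isTrail {H : SimpleGraph V} {u v : V} {p : H.Walk u v}
    (hp : p.IsTrail) : p.edgeSet.ncard = p.length := by
  classical
  have : p.edgeSet = (p.edges.toFinset : Set (Sym2 V)) := by ext; simp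
  rw [this, Set.ncard_coe_finset, List.toFinset_card_of_nodup hp.edges_nodup, Walk.length_edges]

theorem ncard_support_of_isPath {H : SimpleGraph V} {u v : V} {p : H.Walk u v}
    (hp : p.IsPath) : {z | z ∈ p.support}.ncard = p.length + 1 := by
  classical
  have : {z | z ∈ p.support} = (p.support.toFinset : Set V) := by ext; simp
  rw [this, Set.ncard_coe_finset, List.toFinset_card_of_nodup hp.support_nodup,
    Walk.length_support]

theorem IsEar.ncard [Finite V] {K K' : SimpleGraph V} (hKK' : IsEar K K') :
    K'.edgeSet.ncard + K.support.ncard = K.edgeSet.ncard + K'.support.ncard + 1 := by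
  obtain ⟨hle, x, y, w, h, q, hq, hxq, hx, hw, hxy, hqK, hE⟩ := hKK'
  have h1 : K'.edgeSet.ncard = K.edgeSet.ncard + (q.length + 1) := by
    rw [hE, Set.ncard_union_eq (IsEar.edges_disjoint h q hxy hqK) (Set.toFinite _) (Set.toFinite _),
      ncard_edgeSet_of_isTrail, Walk.length_cons]
    exact ((Walk.cons_isPath_iff h q).2 ⟨hq, hxq⟩).isTrail
  have h2 := Set.ncard_union_add_ncard_inter K.support {z | z ∈ q.support}
  have h3 : K.support ∩ {z | z ∈ q.support} = {w} := by
    ext z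
    simp only [Set.mem_inter_iff, Set.mem_ofPred_eq, Set.mem_singleton_iff]
    exact ⟨fun hz => hqK z hz.2 hz.1, by rintro rfl; exact ⟨hw, q.end_mem_support⟩⟩
  rw [← IsEar.support_eq hle h q hx hE, h3, ncard_support_of_isPath hq, Set.ncard_singleton] at h2
  omega

theorem isPath_append {H : SimpleGraph V} {u v w : V} {p : H.Walk u v} {q : H.Walk v w}
    (hp : p.IsPath) (hq : q.IsPath) (h : ∀ x ∈ p.support, x ∈ q.support → x = v) :
    (p.append q).IsPath := by
  rw [Walk.isPath_def, Walk.support_append, List.nodup_append']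
  refine ⟨hp.support_nodup, hq.support_nodup.tail, fun x hx hx' => ?_⟩
  have hxq := h x hx (List.mem_of_mem_tail hx')
  have := hq.support_nodup
  rw [← q.cons_tail_support, List.nodup_cons] at this
  exact this.1 (hxq ▸ hx')

/-- In a graph without cut vertices, there is a path between any two vertices through any given
edge. -/
theorem HasNoCutVertex.exists_isPath_mem_edges [Finite V] {K : SimpleGraph V}
    (hK : HasNoCutVertex K) {u w : V} (hu : u ∈ K.support) (hw : w ∈ K.support) (huw : u ≠ w)
    {e : Sym2 V} (he : e ∈ K.edgeSet) : ∃ p : K.Walk u w, p.IsPath ∧ e ∈ p.edges := by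
  classical
  induction e with
  | _ a b =>
  have hab : K.Adj a b := he
  have hconn : ∀ S : Finset V, S.card < 2 → ∃ t ∈ ({u, w} : Set V), ∃ c ∈ ({a, b} : Set V),
      ∃ p : K.Walk t c, ∀ x ∈ p.support, x ∉ S := by
    intro S hS
    have : ∃ z, S ⊆ {z} := by
      rcases Nat.lt_or_ge S.card 1 with h | h
      · exact ⟨a, by simp [Finset.card_eq_zero.1 (Nat.lt_one_iff.1 h)]⟩
      · obtain ⟨z, rfl⟩ := Finset.card_eq_one.1 (show S.card = 1 by omega)
        exact ⟨z, subset_rfl⟩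
    obtain ⟨z, hz⟩ := this
    obtain ⟨t, ht, htz⟩ : ∃ t ∈ ({u, w} : Set V), t ≠ z := by
      by_cases h : u = z
      · exact ⟨w, by simp, fun h' => huw (h.trans h'.symm)⟩
      · exact ⟨u, by simp, h⟩
    obtain ⟨c, hc, hcz⟩ : ∃ t ∈ ({a, b} : Set V), t ≠ z := by
      by_cases h : a = z
      · exact ⟨b, by simp, fun h' => hab.ne (h.trans h'.symm)⟩
      · exact ⟨a, by simp, h⟩
    obtain ⟨p, hp⟩ := hK z t c (by rcases ht with rfl | rfl <;> assumption)
      (by rcases hc with rfl | rfl; exacts [⟨_, hab⟩, ⟨_, hab.symm⟩]) htz hcz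
    refine ⟨t, ht, c, hc, p, fun x hx hxS => hp ?_⟩
    rwa [← Finset.mem_singleton.1 (hz hxS)]
  obtain ⟨s, t, p, hp, hs, ht, hpB, hdisj⟩ := exists_disjoint_paths _ _ 2 hconn
  have main : ∀ i j, i ≠ j → s i = u → s j = w →
      ∃ p : K.Walk u w, p.IsPath ∧ s(a, b) ∈ p.edges := by
    rintro i j hij rfl rfl
    have htij : t i ≠ t j := fun h => hij (hdisj i j (t i) (p i).end_mem_support
      (by rw [h]; exact (p j).end_mem_support))
    have hst : s(t i, t j) = s(a, b) := by
      have h1 := ht i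
      have h2 := ht j
      simp only [Set.mem_insert_iff, Set.mem_singleton_iff] at h1 h2
      rcases h1 with h1 | h1 <;> rcases h2 with h2 | h2 <;> simp_all [Sym2.eq_swap]
    have hadj : K.Adj (t i) (t j) := by rw [← mem_edgeSet, hst]; exact he
    have hti : t i ∉ (p j).support := fun h => hij (hdisj i j _ (p i).end_mem_support h)
    refine ⟨(p i).append (.cons hadj (p j).reverse), isPath_append (hp i) ?_ ?_, ?_⟩
    · rw [Walk.cons_isPath_iff]
      exact ⟨(hp j).reverse, by simpa using hti⟩
    · intro x hx hx'
      simp only [Walk.support_cons, Walk.support_reverse, List.mem_cons, List.mem_reverse] at hx'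
      rcases hx' with h | h
      · exact h
      · exact absurd (hdisj i j x hx h) hij
    · simp [hst]
  have hs01 : s 0 ≠ s 1 := fun h => absurd (hdisj 0 1 (s 0) (p 0).start_mem_support
      (by rw [h]; exact (p 1).start_mem_support)) (by simp)
  have h0 := hs 0
  have h1 := hs 1
  simp only [Set.mem_insert_iff, Set.mem_singleton_iff] at h0 h1
  rcases h0 with h0 | h0 <;> rcases h1 with h1 | h1
  · exact absurd (h0.trans h1.symm) hs01
  · exact main 0 1 (by simp) h0 h1
  · exact main 1 0 (by simp) h1 h0
  · exact absurd (h0.trans h1.symm) hs01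

theorem IsEar.exists_cycle [Finite V] {K K' : SimpleGraph V} (hKK' : IsEar K K')
    (hK : HasNoCutVertex K) {e : Sym2 V} (he : e ∈ K.edgeSet) :
    ∃ C ∈ cycleEdgeSets K', e ∈ C ∧ ¬ C ⊆ K.edgeSet := by
  obtain ⟨hle, x, y, w, h, q, hq, hxq, hx, hw, hxy, hqK, hE⟩ := hKK'
  obtain ⟨r, hr, her⟩ := hK.exists_isPath_mem_edges hw hx
    (fun h => hxq (h ▸ q.end_mem_support)) he
  have hrs : ∀ z ∈ r.support, z ∈ K.support := by
    intro z hz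
    rw [Walk.mem_support_iff_exists_mem_edges_of_not_nil] at hz
    · obtain ⟨e, he, hae⟩ := hz
      obtain ⟨b, rfl⟩ := hae
      exact ⟨b, r.adj_of_mem_edges he⟩
    · intro hnil
      simp [Walk.edges_eq_nil.2 hnil] at her
  refine ⟨(Walk.cons h (q.append (r.mapLe hle))).edgeSet, ⟨x, _, ?_, rfl⟩, ?_, ?_⟩
  · rw [Walk.cons_isCycle_iff]
    constructor
    · apply isPath_append hq (hr.mapLe hle)
      intro z hz hz'
      exact hqK z hz (hrs z (by simpa using hz'))
    · simp only [Walk.edges_append, Walk.edges_mapLe_eq_edges, List.mem_append, not_or]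
      exact ⟨fun h1 => hxq (q.fst_mem_support_of_mem_edges h1),
        fun h1 => hxy (r.adj_of_mem_edges h1)⟩
  · simp [her]
  · intro hsub
    exact hxy (hsub (show s(x, y) ∈ _ by simp))

theorem IsEar.ssubset {K K' : SimpleGraph V} (hKK' : IsEar K K') : K.edgeSet ⊂ K'.edgeSet := by
  obtain ⟨hle, x, y, w, h, q, hq, hxq, hx, hw, hxy, hqK, hE⟩ := hKK'
  exact ⟨edgeSet_subset_edgeSet.2 hle, fun hs => hxy (hs (show s(x, y) ∈ _ from h))⟩

/-- Induction along an ear decomposition starting with a given edge. -/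
theorem HasNoCutVertex.ear_induction [Finite V] {H : SimpleGraph V} (hH : HasNoCutVertex H)
    {a b : V} (hab : H.Adj a b) (P : SimpleGraph V → Prop) (base : P (edge a b))
    (step : ∀ K K', K' ≤ H → edge a b ≤ K → HasNoCutVertex K → IsEar K K' → P K → P K') : P H := by
  have main : ∀ n (K : SimpleGraph V), H.edgeSet.ncard - K.edgeSet.ncard = n → K ≤ H →
      edge a b ≤ K → HasNoCutVertex K → P K → P H := by
    intro n
    induction n using Nat.strong_induction_on with
    | _ n ih =>
    intro K hn hKH hle hK hPK
    by_cases hne : K = H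
    · exact hne ▸ hPK
    have hadj : K.Adj a b := hle (by simp [edge_adj, hab.ne])
    obtain ⟨K', hK'H, hear⟩ := exists_isEar hH hKH hne ⟨a, b, hadj⟩
    have h1 := Set.ncard_lt_ncard hear.ssubset (Set.toFinite _)
    have h2 := Set.ncard_le_ncard (edgeSet_subset_edgeSet.2 hK'H) (Set.toFinite _)
    exact ih _ (by omega) K' rfl hK'H (hle.trans hear.1) (hear.hasNoCutVertex hK)
      (step K K' hK'H hle hK hear hPK)
  refine main _ (edge a b) rfl ?_ le_rfl ?_ base
  · intro c d hcd
    simp only [edge_adj] at hcd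
    rcases hcd with ⟨⟨rfl, rfl⟩ | ⟨rfl, rfl⟩, -⟩
    exacts [hab, hab.symm]
  · have hs : ∀ c, c ∈ (edge a b).support → c = a ∨ c = b := by
      rintro c ⟨d, hcd : (edge a b).Adj c d⟩
      simp only [edge_adj] at hcd
      tauto
    intro x c d hc hd hcx hdx
    by_cases hcd : c = d
    · subst hcd
      exact ⟨.nil, by simpa using hcx.symm⟩
    · have : (edge a b).Adj c d := by
        simp only [edge_adj]
        rcases hs c hc with rfl | rfl <;> rcases hs d hd with rfl | rfl <;> tauto
      exact ⟨.cons this .nil, by simp [hcx.symm, hdx.symm]⟩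

theorem ncard_edge {a b : V} (hab : a ≠ b) :
    (edge a b).edgeSet.ncard = 1 ∧ (edge a b).support.ncard = 2 := by
  constructor
  · rw [edgeSet_edge_of_ne hab, Set.ncard_singleton]
  · rw [← Set.ncard_pair hab]
    congr 1
    ext c
    simp only [mem_support, edge_adj, Set.mem_insert_iff, Set.mem_singleton_iff]
    constructor
    · rintro ⟨d, h⟩
      tauto
    · rintro (rfl | rfl)
      · exact ⟨b, by tauto⟩
      · exact ⟨a, by tauto⟩

/-- A graph without cut vertices has at least as many cycles through a given edge as its
cyclomatic number. -/
theorem HasNoCutVertex.cyclomatic_le_ncard_cycles_through [Finite V] {H : SimpleGraph V}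
    (hH : HasNoCutVertex H) {e : Sym2 V} (he : e ∈ H.edgeSet) :
    (H.edgeSet.ncard : ℤ) - H.support.ncard + 1 ≤ {C ∈ cycleEdgeSets H | e ∈ C}.ncard := by
  induction e with
  | _ a b =>
  have hab : H.Adj a b := he
  refine hH.ear_induction hab (fun K => (K.edgeSet.ncard : ℤ) - K.support.ncard + 1 ≤
    {C ∈ cycleEdgeSets K | s(a, b) ∈ C}.ncard) ?_ ?_
  · obtain ⟨h1, h2⟩ := ncard_edge hab.ne
    simp only [h1, h2]
    push_cast
    omega
  · intro K K' _ hle hK hear ih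
    obtain ⟨C, hC, heC, hCK⟩ := hear.exists_cycle hK (e := s(a, b))
      (hle (by simp [edge_adj, hab.ne]))
    have hlt : {C ∈ cycleEdgeSets K | s(a, b) ∈ C}.ncard <
        {C ∈ cycleEdgeSets K' | s(a, b) ∈ C}.ncard := by
      apply Set.ncard_lt_ncard _ (Set.toFinite _)
      exact ⟨fun D hD => ⟨cycleEdgeSets_mono hear.1 hD.1, hD.2⟩,
        fun hs => hCK (subset_edgeSet_of_mem_cycleEdgeSets (hs ⟨hC, heC⟩).1)⟩
    have := hear.ncard
    omega

/-- A graph without cut vertices with cyclomatic number `k` has at least `k * (k + 1) / 2`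
cycles. -/
theorem HasNoCutVertex.cyclomatic_le_ncard_cycles [Finite V] {H : SimpleGraph V}
    (hH : HasNoCutVertex H) (hne : H.support.Nonempty) {k : ℤ}
    (hk : k = H.edgeSet.ncard - H.support.ncard + 1) :
    k * (k + 1) ≤ 2 * (cycleEdgeSets H).ncard := by
  subst hk
  obtain ⟨a, b, hab⟩ := hne
  refine hH.ear_induction hab (fun K => ((K.edgeSet.ncard : ℤ) - K.support.ncard + 1) *
    ((K.edgeSet.ncard : ℤ) - K.support.ncard + 1 + 1) ≤ 2 * (cycleEdgeSets K).ncard) ?_ ?_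
  · obtain ⟨h1, h2⟩ := ncard_edge hab.ne
    simp only [h1, h2]
    simp
  · intro K K' _ hle hK hear ih
    obtain ⟨f, hfK', hfK⟩ := Set.exists_of_ssubset hear.ssubset
    have h1 := (hear.hasNoCutVertex hK).cyclomatic_le_ncard_cycles_through hfK'
    have h2 : (cycleEdgeSets K).ncard + {C ∈ cycleEdgeSets K' | f ∈ C}.ncard ≤
        (cycleEdgeSets K').ncard := by
      rw [← Set.ncard_union_eq _ (Set.toFinite _) (Set.toFinite _)]
      · exact Set.ncard_le_ncard (Set.union_subset (cycleEdgeSets_mono hear.1)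
          (fun C hC => hC.1)) (Set.toFinite _)
      · rw [Set.disjoint_left]
        exact fun C hC hC' => hfK (subset_edgeSet_of_mem_cycleEdgeSets hC hC'.2)
    have h3 := hear.ncard
    have h4 : (K'.edgeSet.ncard : ℤ) - K'.support.ncard =
      K.edgeSet.ncard - K.support.ncard + 1 := by omega
    rw [h4] at h1 ⊢
    generalize (K.edgeSet.ncard : ℤ) - K.support.ncard = j at *
    have h5 : ((cycleEdgeSets K).ncard : ℤ) + {C ∈ cycleEdgeSets K' | f ∈ C}.ncard ≤
        (cycleEdgeSets K').ncard := by exact_mod_cast h2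
    nlinarith

end Ear

section K4

variable {G : SimpleGraph V}

/-- Six paths between four vertices which meet only in common ends form a `K₄`-subdivision. -/
theorem exists_isK4SubdivisionOn {b : Fin 4 → V} (hb : Function.Injective b)
    {p01 : G.Walk (b 0) (b 1)} {p02 : G.Walk (b 0) (b 2)} {p03 : G.Walk (b 0) (b 3)}
    {p12 : G.Walk (b 1) (b 2)} {p13 : G.Walk (b 1) (b 3)} {p23 : G.Walk (b 2) (b 3)}
    (i01 : p01.IsPath) (i02 : p02.IsPath) (i03 : p03.IsPath)
    (i12 : p12.IsPath) (i13 : p13.IsPath) (i23 : p23.IsPath)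
    (h1 : ∀ x ∈ p01.support, x ∈ p02.support → x = b 0)
    (h2 : ∀ x ∈ p01.support, x ∈ p03.support → x = b 0)
    (h3 : ∀ x ∈ p02.support, x ∈ p03.support → x = b 0)
    (h4 : ∀ x ∈ p01.support, x ∈ p12.support → x = b 1)
    (h5 : ∀ x ∈ p01.support, x ∈ p13.support → x = b 1)
    (h6 : ∀ x ∈ p12.support, x ∈ p13.support → x = b 1)
    (h7 : ∀ x ∈ p02.support, x ∈ p12.support → x = b 2)
    (h8 : ∀ x ∈ p02.support, x ∈ p23.support → x = b 2)
    (h9 : ∀ x ∈ p12.support, x ∈ p23.support → x = b 2)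
    (h10 : ∀ x ∈ p03.support, x ∈ p13.support → x = b 3)
    (h11 : ∀ x ∈ p03.support, x ∈ p23.support → x = b 3)
    (h12 : ∀ x ∈ p13.support, x ∈ p23.support → x = b 3)
    (h13 : ∀ x ∈ p01.support, x ∉ p23.support)
    (h14 : ∀ x ∈ p02.support, x ∉ p13.support)
    (h15 : ∀ x ∈ p03.support, x ∉ p12.support) :
    ∃ H : G.Subgraph, IsK4SubdivisionOn H b ∧ ∀ e, e ∈ H.edgeSet ↔ e ∈ p01.edges ∨
      e ∈ p02.edges ∨ e ∈ p03.edges ∨ e ∈ p12.edges ∨ e ∈ p13.edges ∨ e ∈ p23.edges := by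
  let P : ∀ p : Fin 4 × Fin 4, p.1 < p.2 → G.Walk (b p.1) (b p.2) := fun p h =>
    match p, h with
    | (0, 1), _ => p01
    | (0, 2), _ => p02
    | (0, 3), _ => p03
    | (1, 2), _ => p12
    | (1, 3), _ => p13
    | (2, 3), _ => p23
    | (0, 0), h | (1, 0), h | (1, 1), h | (2, 0), h | (2, 1), h | (2, 2), h | (3, 0), h
    | (3, 1), h | (3, 2), h | (3, 3), h => absurd h (by decide)
  have ind : ∀ Q : (∀ p : Fin 4 × Fin 4, p.1 < p.2 → Prop), Q (0, 1) (by decide) →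
      Q (0, 2) (by decide) → Q (0, 3) (by decide) → Q (1, 2) (by decide) →
      Q (1, 3) (by decide) → Q (2, 3) (by decide) → ∀ p h, Q p h := by
    rintro Q _ _ _ _ _ _ ⟨i, j⟩ h
    fin_cases i <;> fin_cases j <;> first | exact absurd h (by decide) | assumption
  refine ⟨⨆ (p : Fin 4 × Fin 4) (h : p.1 < p.2), (P p h).toSubgraph,
    ⟨hb, P, ?_, ?_, rfl, ?_⟩, ?_⟩
  · exact ind _ i01 i02 i03 i12 i13 i23
  · have hpos : ∀ {u v : V} (p : G.Walk u v), u ≠ v → 0 < p.length := by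
      intro u v p huv
      rw [Nat.pos_iff_ne_zero]
      exact fun h => huv (Walk.eq_of_length_eq_zero h)
    exact fun p h => hpos _ (hb.ne h.ne)
  · have sym : ∀ {p q : Fin 4 × Fin 4} {L M : List V},
        (∀ x ∈ L, x ∈ M → x ∈ ({b p.1, b p.2} ∩ {b q.1, b q.2} : Set V)) →
        q ≠ p → ∀ x ∈ M, x ∈ L → x ∈ ({b q.1, b q.2} ∩ {b p.1, b p.2} : Set V) :=
      fun h _ x hM hL => (h x hL hM).symm
    have mk : ∀ {p q : Fin 4 × Fin 4} {L M : List V} {z : V}, (∀ x ∈ L, x ∈ M → x = z) →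
        (z ∈ ({b p.1, b p.2} ∩ {b q.1, b q.2} : Set V)) →
        (∀ x ∈ L, x ∈ M → x ∈ ({b p.1, b p.2} ∩ {b q.1, b q.2} : Set V)) :=
      fun h hz x hL hM => h x hL hM ▸ hz
    have mk' : ∀ {p q : Fin 4 × Fin 4} {L M : List V}, (∀ x ∈ L, x ∉ M) →
        (∀ x ∈ L, x ∈ M → x ∈ ({b p.1, b p.2} ∩ {b q.1, b q.2} : Set V)) :=
      fun h x hL hM => absurd hM (h x hL)
    have g1 := mk (p := (0, 1)) (q := (0, 2)) h1 (by simp)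
    have g2 := mk (p := (0, 1)) (q := (0, 3)) h2 (by simp)
    have g3 := mk (p := (0, 2)) (q := (0, 3)) h3 (by simp)
    have g4 := mk (p := (0, 1)) (q := (1, 2)) h4 (by simp)
    have g5 := mk (p := (0, 1)) (q := (1, 3)) h5 (by simp)
    have g6 := mk (p := (1, 2)) (q := (1, 3)) h6 (by simp)
    have g7 := mk (p := (0, 2)) (q := (1, 2)) h7 (by simp)
    have g8 := mk (p := (0, 2)) (q := (2, 3)) h8 (by simp)
    have g9 := mk (p := (1, 2)) (q := (2, 3)) h9 (by simp)
    have g10 := mk (p := (0, 3)) (q := (1, 3)) h10 (by simp)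
    have g11 := mk (p := (0, 3)) (q := (2, 3)) h11 (by simp)
    have g12 := mk (p := (1, 3)) (q := (2, 3)) h12 (by simp)
    have g13 := mk' (p := (0, 1)) (q := (2, 3)) h13
    have g14 := mk' (p := (0, 2)) (q := (1, 3)) h14
    have g15 := mk' (p := (0, 3)) (q := (1, 2)) h15
    intro p q hp hq
    revert q hq
    revert p hp
    apply ind <;> apply ind
    exacts [fun h => absurd rfl h, fun _ => g1, fun _ => g2, fun _ => g4, fun _ => g5, fun _ => g13,
      sym g1, fun h => absurd rfl h, fun _ => g3, fun _ => g7, fun _ => g14, fun _ => g8,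
      sym g2, sym g3, fun h => absurd rfl h, fun _ => g15, fun _ => g10, fun _ => g11,
      sym g4, sym g7, sym g15, fun h => absurd rfl h, fun _ => g6, fun _ => g9,
      sym g5, sym g14, sym g10, sym g6, fun h => absurd rfl h, fun _ => g12,
      sym g13, sym g8, sym g11, sym g9, sym g12, fun h => absurd rfl h]
  · intro e
    simp only [Subgraph.edgeSet_iSup, Set.mem_iUnion, Walk.edgeSet_toSubgraph, Walk.mem_edgeSet]
    constructor
    · rintro ⟨p, h, he⟩
      revert he
      revert p h
      apply ind
      · exact fun h => Or.inl h
      · exact fun h => Or.inr (Or.inl h)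
      · exact fun h => Or.inr (Or.inr (Or.inl h))
      · exact fun h => Or.inr (Or.inr (Or.inr (Or.inl h)))
      · exact fun h => Or.inr (Or.inr (Or.inr (Or.inr (Or.inl h))))
      · exact fun h => Or.inr (Or.inr (Or.inr (Or.inr (Or.inr h))))
    · rintro (h | h | h | h | h | h)
      · exact ⟨(0, 1), by decide, h⟩
      · exact ⟨(0, 2), by decide, h⟩
      · exact ⟨(0, 3), by decide, h⟩
      · exact ⟨(1, 2), by decide, h⟩
      · exact ⟨(1, 3), by decide, h⟩
      · exact ⟨(2, 3), by decide, h⟩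

/-- A vertex of a `K₄`-subdivision with three neighbors is a branch vertex. -/
theorem IsK4SubdivisionOn.mem_range {H : G.Subgraph} {b : Fin 4 → V} (hH : IsK4SubdivisionOn H b)
    {x y₁ y₂ y₃ : V} (h12 : y₁ ≠ y₂) (h13 : y₁ ≠ y₃) (h23 : y₂ ≠ y₃) (h₁ : H.Adj x y₁)
    (h₂ : H.Adj x y₂) (h₃ : H.Adj x y₃) : x ∈ Set.range b := by
  obtain ⟨-, P, hP, -, rfl, hdisj⟩ := hH
  by_contra hx
  simp only [Set.mem_range, not_exists] at hx
  simp only [Subgraph.iSup_adj] at h₁ h₂ h₃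
  obtain ⟨p, hp, h₁⟩ := h₁
  have same : ∀ q hq y, (P q hq).toSubgraph.Adj x y → q = p := by
    intro q hq y h
    by_contra hqp
    have := hdisj q p hq hp hqp x ((P q hq).mem_verts_toSubgraph.1 h.fst_mem)
      ((P p hp).mem_verts_toSubgraph.1 h₁.fst_mem)
    rcases this.1 with h | h
    · exact hx _ h.symm
    · exact hx _ h.symm
  obtain ⟨q, hq, h₂⟩ := h₂
  obtain rfl := same q hq _ h₂
  obtain ⟨r, hr, h₃⟩ := h₃
  obtain rfl := same r hr _ h₃
  obtain ⟨i, rfl, hi⟩ := Walk.mem_support_iff_exists_getVert.1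
    ((P r hr).mem_verts_toSubgraph.1 h₁.fst_mem)
  have h2 := (hP r hr).ncard_neighborSet_toSubgraph_internal_eq_two (i := i)
    (by rintro rfl; exact hx r.1 (by simp))
    (lt_of_le_of_ne hi (by rintro rfl; exact hx r.2 (by simp)))
  have h3 : ({y₁, y₂, y₃} : Set V).ncard = 3 := by
    rw [Set.ncard_eq_three]; exact ⟨_, _, _, h12, h13, h23, rfl⟩
  have := Set.ncard_le_ncard (show ({y₁, y₂, y₃} : Set V) ⊆ _ from by
    rintro y (rfl | rfl | rfl) <;> assumption) (P r hr).finite_neighborSet_toSubgraph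
  omega

theorem three_paths_of_isCycle_append {H : SimpleGraph V} {x y w : V} {p : H.Walk x y}
    {q : H.Walk y w} {r : H.Walk w x} (hc : (p.append (q.append r)).IsCycle) (hxy : x ≠ y)
    (hyw : y ≠ w) (hxw : x ≠ w) : p.IsPath ∧ q.IsPath ∧ r.IsPath ∧
      (∀ a ∈ p.support, a ∈ q.support → a = y) ∧ (∀ a ∈ p.support, a ∈ r.support → a = x) ∧
      (∀ a ∈ q.support, a ∈ r.support → a = w) := by
  have hn := hc.support_nodup
  simp only [Walk.tail_support_append, List.nodup_append', List.disjoint_append_right] at hn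
  obtain ⟨hp, ⟨hq, hr, hqr⟩, hpq, hpr⟩ := hn
  have ex := Walk.end_mem_tail_support_of_ne hxw.symm r
  have ey := Walk.end_mem_tail_support_of_ne hxy p
  have ew := Walk.end_mem_tail_support_of_ne hyw q
  refine ⟨?_, ?_, ?_, ?_, ?_, ?_⟩
  · rw [Walk.isPath_def, ← p.cons_tail_support, List.nodup_cons]
    exact ⟨fun h => hpr h ex, hp⟩
  · rw [Walk.isPath_def, ← q.cons_tail_support, List.nodup_cons]
    exact ⟨fun h => hpq ey h, hq⟩
  · rw [Walk.isPath_def, ← r.cons_tail_support, List.nodup_cons]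
    exact ⟨fun h => hqr ew h, hr⟩
  · intro a h1 h2
    rcases p.mem_support_iff.1 h1 with rfl | h1 <;> rcases q.mem_support_iff.1 h2 with h2 | h2
    exacts [h2, absurd ex (hqr h2), h2, absurd h2 (hpq h1)]
  · intro a h1 h2
    rcases p.mem_support_iff.1 h1 with h1 | h1 <;> rcases r.mem_support_iff.1 h2 with rfl | h2
    exacts [h1, h1, absurd ew (hpq h1), absurd h2 (hpr h1)]
  · intro a h1 h2
    rcases q.mem_support_iff.1 h1 with rfl | h1 <;> rcases r.mem_support_iff.1 h2 with h2 | h2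
    exacts [h2, absurd h2 (hpr ey), h2, absurd h2 (hqr h1)]

/-- Three vertices of a cycle divide it into three paths. -/
theorem exists_three_paths_of_isCycle {H : SimpleGraph V} {z x y w : V} {c : H.Walk z z}
    (hc : c.IsCycle) (hx : x ∈ c.support) (hy : y ∈ c.support) (hw : w ∈ c.support)
    (hxy : x ≠ y) (hyw : y ≠ w) (hxw : x ≠ w) :
    ∃ (p : H.Walk x y) (q : H.Walk x w) (r : H.Walk y w), p.IsPath ∧ q.IsPath ∧ r.IsPath ∧
      (∀ a ∈ p.support, a ∈ q.support → a = x) ∧ (∀ a ∈ p.support, a ∈ r.support → a = y) ∧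
      (∀ a ∈ q.support, a ∈ r.support → a = w) ∧
      (∀ a, a ∈ c.support ↔ a ∈ p.support ∨ a ∈ q.support ∨ a ∈ r.support) ∧
      (∀ e, e ∈ c.edges ↔ e ∈ p.edges ∨ e ∈ q.edges ∨ e ∈ r.edges) := by
  classical
  obtain ⟨c', hc', hs, he⟩ : ∃ c' : H.Walk x x, c'.IsCycle ∧
      (∀ a, a ∈ c'.support ↔ a ∈ c.support) ∧ ∀ e, e ∈ c'.edges ↔ e ∈ c.edges :=
    ⟨c.rotate x hx, hc.rotate hx, fun a => c.mem_support_rotate_iff x hx,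
      fun e => (c.rotate_edges x hx).mem_iff⟩
  simp only [← hs, ← he] at hy hw ⊢
  obtain ⟨p, q, rfl⟩ := c'.mem_support_iff_exists_append.1 hy
  rcases (Walk.mem_support_append_iff _ _).1 hw with hw | hw
  · obtain ⟨p, r, rfl⟩ := p.mem_support_iff_exists_append.1 hw
    rw [← Walk.append_assoc] at hc'
    obtain ⟨h1, h2, h3, h4, h5, h6⟩ := three_paths_of_isCycle_append hc' hxw hyw.symm hxy
    refine ⟨q.reverse, p, r.reverse, h3.reverse, h1, h2.reverse, ?_, ?_, ?_, ?_, ?_⟩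
    all_goals try simp only [Walk.support_reverse, List.mem_reverse, Walk.edges_reverse,
      Walk.mem_support_append_iff, Walk.edges_append, List.mem_append]
    all_goals grind
  · obtain ⟨q, r, rfl⟩ := q.mem_support_iff_exists_append.1 hw
    obtain ⟨h1, h2, h3, h4, h5, h6⟩ := three_paths_of_isCycle_append hc' hxy hyw hxw
    refine ⟨p, r.reverse, q, h1, h3.reverse, h2, ?_, ?_, ?_, ?_, ?_⟩
    all_goals try simp only [Walk.support_reverse, List.mem_reverse, Walk.edges_reverse,
      Walk.mem_support_append_iff, Walk.edges_append, List.mem_append]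
    all_goals grind

theorem IsKConnected.exists_walk [Fintype V] {k : ℕ} (hG : IsKConnected k G) {S : Finset V}
    (hS : S.card < k) {a b : V} (ha : a ∉ S) (hb : b ∉ S) :
    ∃ p : G.Walk a b, ∀ x ∈ p.support, x ∉ S := by
  obtain ⟨p⟩ := (hG.2 S hS).preconnected ⟨a, by simpa using ha⟩ ⟨b, by simpa using hb⟩
  let f : G.induce ((↑S : Set V)ᶜ) →g G := ⟨Subtype.val, fun h => h⟩
  refine ⟨p.map f, fun x hx => ?_⟩
  rw [Walk.support_map, List.mem_map] at hx
  obtain ⟨y, -, rfl⟩ := hx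
  exact y.2

theorem exists_walk_deleteIncidenceSet {v a b : V} (p : G.Walk a b) (hv : v ∉ p.support) :
    ∃ q : (G.deleteIncidenceSet v).Walk a b, q.support = p.support := by
  have h : ∀ e ∈ p.edges, e ∈ (G.deleteIncidenceSet v).edgeSet := by
    intro e he
    induction e with
    | _ c d =>
      rw [mem_edgeSet, deleteIncidenceSet_adj]
      exact ⟨p.adj_of_mem_edges he, fun h => hv (h ▸ p.fst_mem_support_of_mem_edges he),
        fun h => hv (h ▸ p.snd_mem_support_of_mem_edges he)⟩
  exact ⟨p.transfer _ h, by simp⟩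

theorem notMem_support_deleteIncidenceSet {v : V} : v ∉ (G.deleteIncidenceSet v).support := by
  rintro ⟨w, h : (G.deleteIncidenceSet v).Adj v w⟩
  rw [deleteIncidenceSet_adj] at h
  exact h.2.1 rfl

theorem IsKConnected.hasNoCutVertex [Fintype V] (hG : IsKConnected 3 G) (v : V) :
    HasNoCutVertex (G.deleteIncidenceSet v) := by
  classical
  intro x a b ha hb hax hbx
  have hav : a ≠ v := fun h => notMem_support_deleteIncidenceSet (h ▸ ha)
  have hbv : b ≠ v := fun h => notMem_support_deleteIncidenceSet (h ▸ hb)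
  obtain ⟨p, hp⟩ := hG.exists_walk (S := {v, x}) (a := a) (b := b)
    (Nat.lt_succ_of_le Finset.card_le_two) (by simp [hav, hax]) (by simp [hbv, hbx])
  obtain ⟨q, hq⟩ := exists_walk_deleteIncidenceSet p (v := v) (fun h => hp v h (by simp))
  exact ⟨q, fun h => hp x (hq ▸ h) (by simp)⟩

theorem mem_support_of_mem_walk_support {H : SimpleGraph V} {u v x : V} {p : H.Walk u v}
    (hp : ¬ p.Nil) (hx : x ∈ p.support) : x ∈ H.support := by
  rw [Walk.mem_support_iff_exists_mem_edges_of_not_nil hp] at hx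
  obtain ⟨e, he, hae⟩ := hx
  obtain ⟨b, rfl⟩ := hae
  exact ⟨b, p.adj_of_mem_edges he⟩

theorem exists_mem_support_notMem {H : SimpleGraph V} {z : V} {c : H.Walk z z} (hc : c.IsCycle)
    {S : Finset V} (hS : S.card < 3) : ∃ a ∈ c.support, a ∉ S := by
  classical
  by_contra! h
  have h1 : c.support.tail.toFinset ⊆ S := fun a ha =>
    h a (List.mem_of_mem_tail (List.mem_toFinset.1 ha))
  have h2 := Finset.card_le_card h1
  rw [List.toFinset_card_of_nodup hc.support_nodup, List.length_tail, Walk.length_support] at h2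
  have := hc.three_le_length
  omega

/-- In a 3-connected graph, there are three paths from a vertex to any cycle avoiding it which
share only their first vertex. The first vertex is left out here. -/
theorem IsKConnected.exists_fan [Fintype V] (hG : IsKConnected 3 G) {v z : V}
    {c : (G.deleteIncidenceSet v).Walk z z} (hc : c.IsCycle) :
    ∃ (s t : Fin 3 → V) (p : ∀ i, (G.deleteIncidenceSet v).Walk (s i) (t i)),
      (∀ i, (p i).IsPath) ∧ (∀ i, G.Adj v (s i)) ∧ (∀ i, t i ∈ c.support) ∧
      (∀ i, ∀ x ∈ (p i).support, x ∈ c.support → x = t i) ∧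
      ∀ i j x, x ∈ (p i).support → x ∈ (p j).support → i = j := by
  classical
  apply exists_disjoint_paths (G.neighborSet v) {x | x ∈ c.support} 3
  intro S hS
  have hS' : (S.erase v).card < 3 := lt_of_le_of_lt (Finset.card_le_card (S.erase_subset v)) hS
  obtain ⟨a, ha, haS⟩ := exists_mem_support_notMem hc hS'
  have hav : a ≠ v := fun h => notMem_support_deleteIncidenceSet
    (h ▸ mem_support_of_mem_walk_support hc.not_nil ha)
  obtain ⟨p, hp⟩ := hG.exists_walk hS' (S.notMem_erase v) haS
  have hp' : ∀ x ∈ p.bypass.support, x ∉ S.erase v := fun x hx =>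
    hp x (p.support_bypass_subset_support hx)
  have hpath := p.bypass_isPath
  generalize p.bypass = q at hp' hpath
  cases q with
  | nil => exact absurd rfl hav
  | @cons _ t _ h q =>
    rw [Walk.cons_isPath_iff] at hpath
    obtain ⟨r, hr⟩ := exists_walk_deleteIncidenceSet q hpath.2
    refine ⟨t, h, a, ha, r, fun x hx hxS => ?_⟩
    rw [hr] at hx
    exact hp' x (by simp [hx]) (Finset.mem_erase.2 ⟨fun h => hpath.2 (h ▸ hx), hxS⟩)

theorem exists_other_edge_of_mem_cycleEdgeSets {H : SimpleGraph V} {C : Set (Sym2 V)}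
    (hC : C ∈ cycleEdgeSets H) {a b : V} (hab : s(a, b) ∈ C) :
    ∃ d, d ≠ b ∧ s(a, d) ∈ C := by
  obtain ⟨u, p, hp, rfl⟩ := hC
  have h2 := hp.ncard_neighborSet_toSubgraph_eq_two (p.fst_mem_support_of_mem_edges hab)
  obtain ⟨d, hd, hdb⟩ :=
    Set.exists_ne_of_one_lt_ncard (s := p.toSubgraph.neighborSet a) (by omega) b
  exact ⟨d, hdb, by
    rwa [Subgraph.mem_neighborSet, ← Subgraph.mem_edgeSet, Walk.edgeSet_toSubgraph] at hd⟩

/-- A set of edges without vertices of degree one does not contain edges of a path which is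
attached to the rest of the set at most in its last vertex. -/
theorem notMem_of_pendant_path {H : SimpleGraph V} {C : Set (Sym2 V)}
    (hC : ∀ a b, s(a, b) ∈ C → ∃ d, d ≠ b ∧ s(a, d) ∈ C) {s t : V} (p : H.Walk s t)
    (hp : p.IsPath) (h : ∀ x ∈ p.support, x ≠ t → ∀ y, s(x, y) ∈ C → s(x, y) ∈ p.edges) :
    ∀ e ∈ p.edges, e ∉ C := by
  induction p with
  | nil => simp
  | @cons a b t hab p ih =>
    rw [Walk.cons_isPath_iff] at hp
    have hat : a ≠ t := fun h => hp.2 (h ▸ p.end_mem_support)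
    have key : ∀ d, s(a, d) ∈ C → d = b := by
      intro d hd
      have := h a (by simp) hat d hd
      rw [Walk.edges_cons, List.mem_cons] at this
      rcases this with h1 | h1
      · exact Sym2.congr_right.1 h1
      · exact absurd (p.fst_mem_support_of_mem_edges h1) hp.2
    have habC : s(a, b) ∉ C := by
      intro hC1
      obtain ⟨d, hd, hd'⟩ := hC a b hC1
      exact hd (key d hd')
    intro e he
    rw [Walk.edges_cons, List.mem_cons] at he
    rcases he with rfl | he
    · exact habC
    · refine ih hp.1 (fun x hx hxt y hxy => ?_) e he
      have := h x (by simp [hx]) hxt y hxy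
      rw [Walk.edges_cons, List.mem_cons] at this
      rcases this with h1 | h1
      · exact absurd (h1 ▸ hxy) habC
      · exact h1

/-- In a 3-connected graph, each cycle avoiding `v` extends to a `K₄`-subdivision in which `v` is
a branch vertex and which contains no other cycle avoiding `v`. -/
theorem IsKConnected.exists_isK4Subdivision [Fintype V] (hG : IsKConnected 3 G) {v : V}
    {C : Set (Sym2 V)} (hC : C ∈ cycleEdgeSets (G.deleteIncidenceSet v)) :
    ∃ H : G.Subgraph, IsK4Subdivision H ∧ C ⊆ H.edgeSet ∧
      (∀ C' ∈ cycleEdgeSets (G.deleteIncidenceSet v), C' ⊆ H.edgeSet → C' ⊆ C) ∧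
      ∀ b, IsK4SubdivisionOn H b → v ∈ Set.range b := by
  classical
  obtain ⟨z, c, hc, rfl⟩ := hC
  obtain ⟨s, t, p, hp, hs, ht, hpc, hpp⟩ := hG.exists_fan hc
  have hD := deleteIncidenceSet_le G v
  have hne : ∀ i j, i ≠ j → t i ≠ t j := fun i j hij h => hij
    (hpp i j (t i) (p i).end_mem_support (by rw [h]; exact (p j).end_mem_support))
  have hvc : v ∉ c.support := fun h => notMem_support_deleteIncidenceSet
    (mem_support_of_mem_walk_support hc.not_nil h)
  have hvp : ∀ i, v ∉ (p i).support := by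
    intro i h
    by_cases hn : (p i).Nil
    · have := Walk.nil_iff_support_eq.1 hn
      rw [this, List.mem_singleton] at h
      exact (hs i).ne h
    · exact notMem_support_deleteIncidenceSet (mem_support_of_mem_walk_support hn h)
  obtain ⟨q, r, u, hq, hr, hu, hqr, hqu, hru, hsc, hec⟩ := exists_three_paths_of_isCycle hc
    (ht 0) (ht 1) (ht 2) (hne 0 1 (by decide)) (hne 1 2 (by decide)) (hne 0 2 (by decide))
  have hvt : ∀ i, v ≠ t i := fun i h => hvc (h ▸ ht i)
  have h01 := hne 0 1 (by decide)
  have h02 := hne 0 2 (by decide)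
  have h12 := hne 1 2 (by decide)
  have hb : Function.Injective ![v, t 0, t 1, t 2] := by
    have h0 := hvt 0
    have h1 := hvt 1
    have h2 := hvt 2
    clear * - h01 h02 h12 h0 h1 h2
    rw [← List.nodup_ofFn]
    simp [*]
  let f : ∀ i, G.Walk v (t i) := fun i => .cons (hs i) ((p i).mapLe hD)
  have hfs : ∀ i x, x ∈ (f i).support ↔ x = v ∨ x ∈ (p i).support := by
    intro i x
    simp [f]
  have hfp : ∀ i, (f i).IsPath := by
    intro i
    rw [Walk.cons_isPath_iff]
    exact ⟨(hp i).mapLe hD, by simpa using hvp i⟩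
  have hff : ∀ i j, i ≠ j → ∀ x ∈ (f i).support, x ∈ (f j).support → x = v := by
    intro i j hij x hi hj
    rw [hfs] at hi hj
    rcases hi with rfl | hi
    · rfl
    · rcases hj with rfl | hj
      · rfl
      · exact absurd (hpp i j x hi hj) hij
  have hfc : ∀ i x, x ∈ (f i).support → x ∈ c.support → x = t i := by
    intro i x hi hxc
    rw [hfs] at hi
    rcases hi with rfl | hi
    · exact absurd hxc hvc
    · exact hpc i x hi hxc
  have hqc : ∀ x ∈ (q.mapLe hD).support, x ∈ c.support ∧ x ∈ q.support := by
    intro x hx; simp at hx; simp [hsc, hx]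
  have hrc : ∀ x ∈ (r.mapLe hD).support, x ∈ c.support ∧ x ∈ r.support := by
    intro x hx; simp at hx; simp [hsc, hx]
  have huc : ∀ x ∈ (u.mapLe hD).support, x ∈ c.support ∧ x ∈ u.support := by
    intro x hx; simp at hx; simp [hsc, hx]
  obtain ⟨H, hH, hE⟩ := exists_isK4SubdivisionOn (b := ![v, t 0, t 1, t 2]) hb
    (p01 := f 0) (p02 := f 1) (p03 := f 2) (p12 := q.mapLe hD) (p13 := r.mapLe hD)
    (p23 := u.mapLe hD) (hfp 0) (hfp 1) (hfp 2) (hq.mapLe hD) (hr.mapLe hD) (hu.mapLe hD)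
    (hff 0 1 (by decide)) (hff 0 2 (by decide)) (hff 1 2 (by decide))
    (fun x h1 h2 => hfc 0 x h1 (hqc x h2).1)
    (fun x h1 h2 => hfc 0 x h1 (hrc x h2).1)
    (fun x h1 h2 => hqr x (hqc x h1).2 (hrc x h2).2)
    (fun x h1 h2 => hfc 1 x h1 (hqc x h2).1)
    (fun x h1 h2 => hfc 1 x h1 (huc x h2).1)
    (fun x h1 h2 => hqu x (hqc x h1).2 (huc x h2).2)
    (fun x h1 h2 => hfc 2 x h1 (hrc x h2).1)
    (fun x h1 h2 => hfc 2 x h1 (huc x h2).1)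
    (fun x h1 h2 => hru x (hrc x h1).2 (huc x h2).2)
    (fun x h1 h2 => by
      obtain rfl := hfc 0 x h1 (huc x h2).1
      exact h01 (hqu _ q.start_mem_support (huc _ h2).2))
    (fun x h1 h2 => by
      obtain rfl := hfc 1 x h1 (hrc x h2).1
      exact h12 (hru _ (hrc _ h2).2 u.start_mem_support))
    (fun x h1 h2 => by
      obtain rfl := hfc 2 x h1 (hqc x h2).1
      exact h12 (hqu _ (hqc _ h2).2 u.end_mem_support).symm)
  have hE' : ∀ e, e ∈ H.edgeSet ↔ (∃ i, e ∈ (f i).edges) ∨ e ∈ c.edges := by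
    intro e
    have h : e ∈ H.edgeSet ↔ e ∈ (f 0).edges ∨ e ∈ (f 1).edges ∨ e ∈ (f 2).edges ∨
      e ∈ (q.mapLe hD).edges ∨ e ∈ (r.mapLe hD).edges ∨ e ∈ (u.mapLe hD).edges := hE e
    simp only [Walk.edges_mapLe_eq_edges] at h
    rw [h, hec]
    simp only [Fin.exists_fin_succ, Fin.exists_fin_zero, Fin.succ_zero_eq_one,
      Fin.succ_one_eq_two, or_false, or_assoc]
  refine ⟨H, ⟨_, hH⟩, fun e he => (hE' e).2 (Or.inr he), ?_, ?_⟩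
  · intro C' hC' hsub
    have hvC' : ∀ y, s(v, y) ∉ C' := fun y hy => notMem_support_deleteIncidenceSet
      ⟨y, subset_edgeSet_of_mem_cycleEdgeSets hC' hy⟩
    have hpend : ∀ i, ∀ e ∈ (p i).edges, e ∉ C' := by
      intro i
      refine notMem_of_pendant_path
        (fun a b hab => exists_other_edge_of_mem_cycleEdgeSets hC' hab) (p i) (hp i) ?_
      intro x hx hxt y hxy
      have hxv : x ≠ v := fun h => hvC' y (h ▸ hxy)
      rcases (hE' _).1 (hsub hxy) with ⟨j, hj⟩ | h1
      · have h2 := (hfs j x).1 ((f j).fst_mem_support_of_mem_edges hj)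
        have h3 : x ∈ (p j).support := h2.resolve_left hxv
        obtain rfl := hpp i j x hx h3
        simp only [f, Walk.edges_cons, List.mem_cons, Walk.edges_mapLe_eq_edges] at hj
        rcases hj with hj | hj
        · exact absurd hxy (hj ▸ hvC' _)
        · exact hj
      · exact absurd (hpc i x hx (c.fst_mem_support_of_mem_edges h1)) hxt
    intro e he
    rcases (hE' _).1 (hsub he) with ⟨j, hj⟩ | h1
    · simp only [f, Walk.edges_cons, List.mem_cons, Walk.edges_mapLe_eq_edges] at hj
      rcases hj with rfl | hj
      · exact absurd he (hvC' _)
      · exact absurd he (hpend j e hj)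
    · exact h1
  · intro b hb
    have hadj : ∀ i, H.Adj v (s i) := by
      intro i
      rw [← Subgraph.mem_edgeSet, hE']
      exact Or.inl ⟨i, by simp [f]⟩
    have hss : ∀ i j, i ≠ j → s i ≠ s j := fun i j hij h => hij
      (hpp i j (s i) (p i).start_mem_support (by rw [h]; exact (p j).start_mem_support))
    exact hb.mem_range (hss 0 1 (by decide)) (hss 0 2 (by decide)) (hss 1 2 (by decide))
      (hadj 0) (hadj 1) (hadj 2)

end K4

section Counting

variable [Fintype V] {G : SimpleGraph V}

theorem IsKConnected.three_le_degree [DecidableRel G.Adj] (hG : IsKConnected 3 G) (v : V) :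
    3 ≤ G.degree v := by
  classical
  by_contra! h
  rw [← card_neighborFinset_eq_degree] at h
  obtain ⟨w, -, hw⟩ := Finset.exists_mem_notMem_of_card_lt_card
    (s := insert v (G.neighborFinset v)) (t := Finset.univ)
    (lt_of_le_of_lt (Finset.card_insert_le _ _) (by rw [Finset.card_univ]; have := hG.1; omega))
  rw [Finset.mem_insert, not_or] at hw
  obtain ⟨p, hp⟩ := hG.exists_walk h (a := v) (b := w) (by simp) hw.2
  cases p with
  | nil => exact hw.1 rfl
  | @cons _ y _ hy p => exact hp y (by simp) (by simpa using hy)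

theorem IsKConnected.support_deleteIncidenceSet (hG : IsKConnected 3 G) (v : V) :
    (G.deleteIncidenceSet v).support = {v}ᶜ := by
  classical
  ext w
  refine ⟨fun h hw => notMem_support_deleteIncidenceSet (hw ▸ h), fun hw => ?_⟩
  have h3 := hG.three_le_degree w
  rw [← card_neighborFinset_eq_degree] at h3
  obtain ⟨y, hy, hyv⟩ := Finset.exists_mem_ne (s := G.neighborFinset w) (by omega) v
  exact ⟨y, deleteIncidenceSet_adj.2 ⟨by simpa using hy, hw, hyv⟩⟩

/-- A 3-connected graph has at most four times as many pairs of a vertex and a cycle avoiding it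
as `K₄`-subdivisions. -/
theorem IsKConnected.sum_ncard_cycleEdgeSets_le (hG : IsKConnected 3 G) :
    ∑ v, (cycleEdgeSets (G.deleteIncidenceSet v)).ncard ≤
      4 * {H : G.Subgraph | IsK4Subdivision H}.ncard := by
  classical
  choose! F hF using fun v C (hC : C ∈ cycleEdgeSets (G.deleteIncidenceSet v)) =>
    hG.exists_isK4Subdivision hC
  let S : Finset (Σ _ : V, Set (Sym2 V)) := Finset.univ.sigma fun v =>
    (Set.toFinite (cycleEdgeSets (G.deleteIncidenceSet v))).toFinset
  let T : Finset G.Subgraph := (Set.toFinite {H : G.Subgraph | IsK4Subdivision H}).toFinset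
  have hS : S.card = ∑ v, (cycleEdgeSets (G.deleteIncidenceSet v)).ncard := by
    rw [Finset.card_sigma]
    exact Finset.sum_congr rfl fun v _ => (Set.ncard_eq_toFinset_card _ _).symm
  have hT : T.card = {H : G.Subgraph | IsK4Subdivision H}.ncard :=
    (Set.ncard_eq_toFinset_card _ _).symm
  have hmem : ∀ {x}, x ∈ S → x.2 ∈ cycleEdgeSets (G.deleteIncidenceSet x.1) := by
    intro x hx
    simpa [S] using hx
  rw [← hS, ← hT]
  refine Finset.card_le_mul_card_image_of_maps_to (f := fun x => F x.1 x.2)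
    (fun x hx => by simpa [T] using (hF _ _ (hmem hx)).1) 4 fun H hH => ?_
  obtain ⟨b, hb⟩ : IsK4Subdivision H := by simpa [T] using hH
  calc _ ≤ (Finset.univ.image b).card := by
        refine Finset.card_le_card_of_injOn Sigma.fst ?_ ?_
        · intro x hx
          obtain ⟨hxS, rfl⟩ := Finset.mem_filter.1 hx
          simpa using (hF _ _ (hmem hxS)).2.2.2 b hb
        · rintro ⟨v, C⟩ hx ⟨w, C'⟩ hy (rfl : v = w)
          obtain ⟨hxS, rfl⟩ := Finset.mem_filter.1 hx
          obtain ⟨hyS, hxy⟩ := Finset.mem_filter.1 hy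
          have h1 := hF _ _ (hmem hxS)
          have h2 := hF _ _ (hmem hyS)
          dsimp only at h1 h2 hxy
          rw [hxy] at h2
          have := Set.Subset.antisymm (h2.2.2.1 C (hmem hxS) h1.2.1)
            (h1.2.2.1 C' (hmem hyS) h2.2.1)
          rw [this]
    _ ≤ 4 := Finset.card_image_le

end Counting

/-- Every 3-connected graph on `n` vertices contains at least
`n³/32 - n²/16` distinct `K₄`-subdivisions. -/
theorem stmt10 [Fintype V] {G : SimpleGraph V} (hG : IsKConnected 3 G) :
    (Fintype.card V : ℝ) ^ 3 / 32 - (Fintype.card V : ℝ) ^ 2 / 16 ≤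
      ({H : G.Subgraph | IsK4Subdivision H}.ncard : ℝ) := by
  classical
  set n := Fintype.card V with hn
  set m := G.edgeFinset.card with hm
  have hn3 : 3 < n := hG.1
  have hdeg : ∑ v, G.degree v = 2 * m := G.sum_degrees_eq_twice_card_edges
  have hmn : 3 * n ≤ 2 * m := by
    rw [← hdeg, hn, ← Finset.card_univ, mul_comm, ← smul_eq_mul]
    exact Finset.card_nsmul_le_sum _ _ _ fun v _ => hG.three_le_degree v
  have hcyc : ∀ v, ((m : ℝ) - G.degree v - n + 2) * ((m - G.degree v - n + 2) + 1) ≤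
      2 * (cycleEdgeSets (G.deleteIncidenceSet v)).ncard := by
    intro v
    have hsupp : (G.deleteIncidenceSet v).support.ncard = n - 1 := by
      rw [hG.support_deleteIncidenceSet, Set.ncard_compl, Set.ncard_singleton,
        Nat.card_eq_fintype_card]
    have hedge : (G.deleteIncidenceSet v).edgeSet.ncard = m - G.degree v := by
      rw [← card_edgeFinset_deleteIncidenceSet, ← coe_edgeFinset, Set.ncard_coe_finset]
    have hle : G.degree v ≤ m := by
      rw [← card_incidenceFinset_eq_degree]
      exact Finset.card_le_card (G.incidenceFinset_subset v)
    have h := (hG.hasNoCutVertex v).cyclomatic_le_ncard_cycles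
      (Set.nonempty_of_ncard_ne_zero (by omega)) rfl
    rw [hsupp, hedge, Nat.cast_sub hle, Nat.cast_sub (by omega)] at h
    have h' : ((m : ℤ) - G.degree v - n + 2) * ((m - G.degree v - n + 2) + 1) ≤
        2 * (cycleEdgeSets (G.deleteIncidenceSet v)).ncard := by
      convert h using 1
      push_cast
      ring
    exact_mod_cast h'
  have hsum : (∑ v, ((cycleEdgeSets (G.deleteIncidenceSet v)).ncard : ℝ)) ≤
      4 * {H : G.Subgraph | IsK4Subdivision H}.ncard :=
    mod_cast hG.sum_ncard_cycleEdgeSets_le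
  have hlow : ∑ v, (((n : ℝ) - 1) * (m - G.degree v - n + 2) - ((n - 2) / 2) ^ 2) ≤
      ∑ v, 2 * ((cycleEdgeSets (G.deleteIncidenceSet v)).ncard : ℝ) := by
    refine Finset.sum_le_sum fun v _ => le_trans ?_ (hcyc v)
    nlinarith [sq_nonneg ((m : ℝ) - G.degree v - n + 2 - (n - 2) / 2)]
  have hdeg' : ∑ v, (G.degree v : ℝ) = 2 * m := mod_cast hdeg
  have hval : ∑ v, (((n : ℝ) - 1) * (m - G.degree v - n + 2) - ((n - 2) / 2) ^ 2) =
      ((n : ℝ) - 1) * ((n - 2) * (m - n)) - n * ((n - 2) / 2) ^ 2 := by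
    simp only [Finset.sum_sub_distrib, Finset.sum_add_distrib, ← Finset.mul_sum, hdeg',
      Finset.sum_const, Finset.card_univ, nsmul_eq_mul, ← hn]
    ring
  rw [hval, ← Finset.mul_sum] at hlow
  have hmn' : (3 : ℝ) * n ≤ 2 * m := mod_cast hmn
  have hn3' : (3 : ℝ) < n := mod_cast hn3
  have : 0 ≤ ((n : ℝ) - 1) * (n - 2) * (2 * m - 3 * n) :=
    mul_nonneg (mul_nonneg (by linarith) (by linarith)) (by linarith)
  nlinarith
end

section
/- Let G be a 3-connected graph with n vertices, m edges and vertex degrees d_1,...,d_n, and set a := m − n + 2. Then the number of distinct K4-subdivisions contained in G is at least (1/4)·∑_{i=1}^{n} ⌈(1/3)·binom(d_i, 2)⌉ · binom(a − d_i + 1, 2). -/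
open SimpleGraph

variable {V : Type*}

namespace SimpleGraph

namespace Walk

/-- A walk can be cut at its first visit to a set `A` containing its last vertex. -/
lemma exists_isPath_first_mem {H : SimpleGraph V} (A : Set V) {x t : V} (p : H.Walk x t)
    (ht : t ∈ A) : ∃ w ∈ A, ∃ q : H.Walk x w, q.IsPath ∧ q.support ⊆ p.support ∧
      ∀ a ∈ q.support, a ∈ A → a = w := by
  classical
  suffices h : ∃ w ∈ A, ∃ q : H.Walk x w, q.support ⊆ p.support ∧
      ∀ a ∈ q.support, a ∈ A → a = w by
    obtain ⟨w, hw, q, hq, hqA⟩ := h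
    exact ⟨w, hw, q.bypass, q.bypass_isPath, fun a ha => hq (q.support_bypass_subset_support ha),
      fun a ha => hqA a (q.support_bypass_subset_support ha)⟩
  induction p with
  | nil => exact ⟨_, ht, nil, by simp, by simp⟩
  | @cons u v _ h p ih =>
    by_cases hu : u ∈ A
    · exact ⟨u, hu, nil, by simp, by simp⟩
    · obtain ⟨w, hw, q, hq, hqA⟩ := ih ht
      refine ⟨w, hw, cons h q, ?_, ?_⟩
      · simp only [support_cons]
        exact List.cons_subset_cons _ hq
      · intro a ha haA
        rw [support_cons, List.mem_cons] at ha
        rcases ha with rfl | ha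
        · exact absurd haA hu
        · exact hqA a ha haA

lemma IsPath.append_of_inter {H : SimpleGraph V} {u v w : V} {p : H.Walk u v} {q : H.Walk v w}
    (hp : p.IsPath) (hq : q.IsPath) (h : ∀ a ∈ p.support, a ∈ q.support → a = v) :
    (p.append q).IsPath := by
  rw [isPath_def, support_append, List.nodup_append]
  refine ⟨hp.support_nodup, hq.support_nodup.tail, ?_⟩
  rintro a ha b hb rfl
  obtain rfl := h a ha (List.mem_of_mem_tail hb)
  have := hq.support_nodup
  rw [← cons_tail_support] at this
  exact (List.nodup_cons.mp this).1 hb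

end Walk

/-- The vertices that can be reached from `A` in `H` by a walk avoiding `X`. -/
def reachAvoiding (H : SimpleGraph V) (A X : Set V) : Set V :=
  {z | ∃ a ∈ A, ∃ p : H.Walk a z, ∀ u ∈ p.support, u ∉ X}

lemma mem_reachAvoiding_self {H : SimpleGraph V} {A X : Set V} {a : V} (ha : a ∈ A)
    (haX : a ∉ X) : a ∈ H.reachAvoiding A X :=
  ⟨a, ha, .nil, by simpa using haX⟩

lemma mem_reachAvoiding_of_adj {H : SimpleGraph V} {A X : Set V} {x y : V}
    (hx : x ∈ H.reachAvoiding A X) (h : H.Adj x y) (hy : y ∉ X) : y ∈ H.reachAvoiding A X := by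
  obtain ⟨a, ha, p, hp⟩ := hx
  refine ⟨a, ha, p.concat h, ?_⟩
  intro u hu
  rw [Walk.support_concat, List.mem_append, List.mem_singleton] at hu
  rcases hu with hu | rfl
  · exact hp u hu
  · exact hy

lemma notMem_of_mem_reachAvoiding {H : SimpleGraph V} {A X : Set V} {x : V}
    (hx : x ∈ H.reachAvoiding A X) : x ∉ X := by
  obtain ⟨a, ha, p, hp⟩ := hx
  exact hp _ p.end_mem_support

lemma reachAvoiding_mono {H : SimpleGraph V} {A X Y : Set V} (h : X ⊆ Y) :
    H.reachAvoiding A Y ⊆ H.reachAvoiding A X := by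
  rintro z ⟨a, ha, p, hp⟩
  exact ⟨a, ha, p, fun u hu hX => hp u hu (h hX)⟩

/-- Every walk in `H` from `A` to `B` meets `X`. -/
def Separates (H : SimpleGraph V) (A B X : Set V) : Prop :=
  ∀ a ∈ A, ∀ b ∈ B, ∀ p : H.Walk a b, ∃ x ∈ p.support, x ∈ X

lemma Separates.symm {H : SimpleGraph V} {A B X : Set V} (h : H.Separates A B X) :
    H.Separates B A X := by
  intro b hb a ha p
  obtain ⟨x, hx, hX⟩ := h a ha b hb p.reverse
  exact ⟨x, by simpa using hx, hX⟩

lemma Separates.notMem_reachAvoiding {H : SimpleGraph V} {A B X : Set V} (h : H.Separates A B X)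
    {b : V} (hb : b ∈ B) : b ∉ H.reachAvoiding A X := by
  rintro ⟨a, ha, p, hp⟩
  obtain ⟨x, hx, hX⟩ := h a ha b hb p
  exact hp x hx hX

lemma Separates.disjoint_reachAvoiding {H : SimpleGraph V} {A B X : Set V}
    (h : H.Separates A B X) {z : V} (hA : z ∈ H.reachAvoiding A X) :
    z ∉ H.reachAvoiding B X := by
  rintro ⟨b, hb, q, hq⟩
  obtain ⟨a, ha, p, hp⟩ := hA
  obtain ⟨x, hx, hX⟩ := h a ha b hb (p.append q.reverse)
  rw [Walk.mem_support_append_iff, Walk.support_reverse, List.mem_reverse] at hx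
  exact hx.elim (fun hx => hp x hx hX) (fun hx => hq x hx hX)

/-- There are `k` pairwise disjoint walks from `A` to `B`. -/
def Linked (H : SimpleGraph V) (A B : Set V) (k : ℕ) : Prop :=
  ∃ (a b : Fin k → V) (p : ∀ i, H.Walk (a i) (b i)), (∀ i, a i ∈ A) ∧ (∀ i, b i ∈ B) ∧
    (∀ i, (p i).IsPath) ∧ ∀ i j x, x ∈ (p i).support → x ∈ (p j).support → i = j

lemma Linked.mono {H K : SimpleGraph V} (h : H ≤ K) {A B : Set V} {k : ℕ} (hL : H.Linked A B k) :
    K.Linked A B k := by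
  obtain ⟨a, b, p, ha, hb, hp, hd⟩ := hL
  refine ⟨a, b, fun i => (p i).mapLe h, ha, hb, fun i => by simpa using hp i, ?_⟩
  intro i j x hi hj
  rw [Walk.support_mapLe_eq_support] at hi hj
  exact hd i j x hi hj

/-- If deleting the edge `xy` makes `X` separate `A` from `B`, where `x` is on the side of `A`
and `y` is not, then a set separating `A` from `X ∪ {x}` without using `xy` separates `A`
from `B`. -/
lemma Separates.of_deleteEdges_left {H : SimpleGraph V} {A B X Y : Set V} {x y : V}
    (hX : (H.deleteEdges {s(x, y)}).Separates A B X)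
    (hy : y ∉ (H.deleteEdges {s(x, y)}).reachAvoiding A X)
    (hY : (H.deleteEdges {s(x, y)}).Separates A (insert x X) Y) : H.Separates A B Y := by
  intro a ha b hb p
  by_contra! hp
  have hP : ∀ z ∈ insert x X, z ∉ (H.deleteEdges {s(x, y)}).reachAvoiding A Y :=
    fun z hz => hY.notMem_reachAvoiding hz
  have hsub : (H.deleteEdges {s(x, y)}).reachAvoiding A (X ∪ Y) ⊆
      (H.deleteEdges {s(x, y)}).reachAvoiding A Y := reachAvoiding_mono Set.subset_union_right
  have hsub' : (H.deleteEdges {s(x, y)}).reachAvoiding A (X ∪ Y) ⊆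
      (H.deleteEdges {s(x, y)}).reachAvoiding A X := reachAvoiding_mono Set.subset_union_left
  have haY := hp a p.start_mem_support
  have haX : a ∉ X := fun h =>
    hP a (Set.mem_insert_of_mem _ h) (mem_reachAvoiding_self ha haY)
  obtain ⟨d, hd, hf, hs⟩ := p.exists_boundary_dart
    ((H.deleteEdges {s(x, y)}).reachAvoiding A (X ∪ Y))
    (mem_reachAvoiding_self ha (by simp [haX, haY]))
    (fun h => hX.notMem_reachAvoiding hb (hsub' h))
  have hsY := hp _ (p.dart_snd_mem_support_of_mem_darts hd)
  by_cases he : s(d.fst, d.snd) = s(x, y)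
  · rw [Sym2.eq_iff] at he
    rcases he with ⟨h1, h2⟩ | ⟨h1, h2⟩
    · rw [h1] at hf
      exact hP x (Set.mem_insert _ _) (hsub hf)
    · rw [h1] at hf
      exact hy (hsub' hf)
  · have hadj : (H.deleteEdges {s(x, y)}).Adj d.fst d.snd := by
      rw [deleteEdges_adj]
      exact ⟨d.adj, he⟩
    have hsX : d.snd ∉ X := fun h =>
      hP _ (Set.mem_insert_of_mem _ h) (mem_reachAvoiding_of_adj (hsub hf) hadj hsY)
    exact hs (mem_reachAvoiding_of_adj hf hadj (by simp [hsX, hsY]))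

/-- Gluing linkages from `A` to `X ∪ {x}` and from `X ∪ {y}` to `B` along `X` and the edge
`xy`. -/
lemma Linked.glue {H K : SimpleGraph V} (hK : K ≤ H) {A B : Set V} {X : Finset V} {x y : V}
    (hxy : H.Adj x y) (hx : x ∉ X) (hy : y ∉ X) (hX : K.Separates A B X)
    (h1 : K.Linked A (insert x (X : Set V)) (X.card + 1))
    (h2 : K.Linked (insert y (X : Set V)) B (X.card + 1)) : H.Linked A B (X.card + 1) := by
  classical
  obtain ⟨a, e, p, ha, he, hp, hpd⟩ := h1
  obtain ⟨s, b, q, hs, hb, hq, hqd⟩ := h2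
  have he_inj : Function.Injective e := fun i j hij =>
    hpd i j (e i) (p i).end_mem_support (by rw [hij]; exact (p j).end_mem_support)
  have hs_inj : Function.Injective s := fun i j hij =>
    hqd i j (s i) (q i).start_mem_support (by rw [hij]; exact (q j).start_mem_support)
  have he_surj : ∀ z ∈ insert x (X : Set V), ∃ i, e i = z := by
    intro z hz
    have := Finset.eq_of_subset_of_card_le (s := Finset.univ.image e) (t := insert x X)
      (by intro u hu; simp only [Finset.mem_image, Finset.mem_univ, true_and] at hu
          obtain ⟨i, rfl⟩ := hu; simpa using he i)
      (by rw [Finset.card_image_of_injective _ he_inj, Finset.card_insert_of_notMem hx]; simp)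
    have hz' : z ∈ Finset.univ.image e := by rw [this]; simpa using hz
    simpa using hz'
  have hs_surj : ∀ z ∈ insert y (X : Set V), ∃ i, s i = z := by
    intro z hz
    have := Finset.eq_of_subset_of_card_le (s := Finset.univ.image s) (t := insert y X)
      (by intro u hu; simp only [Finset.mem_image, Finset.mem_univ, true_and] at hu
          obtain ⟨i, rfl⟩ := hu; simpa using hs i)
      (by rw [Finset.card_image_of_injective _ hs_inj, Finset.card_insert_of_notMem hy]; simp)
    have hz' : z ∈ Finset.univ.image s := by rw [this]; simpa using hz
    simpa using hz'
  have hpX : ∀ i, ∀ z ∈ (p i).support, z ∈ X → z = e i := by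
    intro i z hz hzX
    obtain ⟨j, rfl⟩ := he_surj z (by simp [hzX])
    rw [hpd i j _ hz (p j).end_mem_support]
  have hqX : ∀ i, ∀ z ∈ (q i).support, z ∈ X → z = s i := by
    intro i z hz hzX
    obtain ⟨j, rfl⟩ := hs_surj z (by simp [hzX])
    rw [hqd i j _ hz (q j).start_mem_support]
  have hpq : ∀ i j z, z ∈ (p i).support → z ∈ (q j).support → z ∈ X := by
    intro i j z hzp hzq
    by_contra hzX
    obtain ⟨p1, p2, hp1, hp2, hpe⟩ := (hp i).mem_support_iff_exists_append.mp hzp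
    obtain ⟨q1, q2, hq1, hq2, hqe⟩ := (hq j).mem_support_iff_exists_append.mp hzq
    obtain ⟨w, hw, hwX⟩ := hX _ (ha i) _ (hb j) (p1.append q2)
    rw [Walk.mem_support_append_iff] at hw
    rcases hw with hw | hw
    · have h1 := hpX i w (by rw [hpe, Walk.mem_support_append_iff]; exact Or.inl hw) hwX
      have h2 := Walk.IsPath.ne_of_mem_support_of_append
        (by rw [← hpe]; exact hp i : (p1.append p2).IsPath)
        (y := w) (x := w) (by rintro rfl; exact hzX hwX) hw (h1 ▸ p2.end_mem_support)
      exact h2 rfl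
    · have h1 := hqX j w (by rw [hqe, Walk.mem_support_append_iff]; exact Or.inr hw) hwX
      have h2 := Walk.IsPath.ne_of_mem_support_of_append
        (by rw [← hqe]; exact hq j : (q1.append q2).IsPath)
        (y := w) (x := w) (by rintro rfl; exact hzX hwX) (h1 ▸ q1.start_mem_support) hw
      exact h2 rfl
  have hglue : ∀ i, ∃ j, ∃ r : H.Walk (a i) (b j), r.IsPath ∧
      (∀ z ∈ r.support, z ∈ (p i).support ∨ z ∈ (q j).support) ∧
      (e i ∈ X ∧ s j = e i ∨ e i = x ∧ s j = y) := by
    intro i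
    by_cases hi : e i ∈ X
    · obtain ⟨j, hj⟩ := hs_surj (e i) (by simp [hi])
      refine ⟨j, ((p i).append ((q j).copy hj rfl)).mapLe hK, ?_, ?_, Or.inl ⟨hi, hj⟩⟩
      · rw [Walk.isPath_mapLe]
        refine (hp i).append_of_inter (by simpa using hq j) ?_
        intro z hz hz'
        rw [Walk.support_copy] at hz'
        exact hpX i z hz (hpq i j z hz hz')
      · intro z hz
        rwa [Walk.support_mapLe_eq_support, Walk.mem_support_append_iff, Walk.support_copy] at hz
    · have hix : e i = x := by simpa [hi] using he i
      obtain ⟨j, hj⟩ := hs_surj y (by simp)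
      have hne : ∀ z, z ∈ (p i).support → z ∈ (q j).support → False := by
        intro z h1 h2
        have hz := hpq i j z h1 h2
        exact hi (hpX i z h1 hz ▸ hz)
      have hadj : H.Adj (e i) (s j) := by rw [hix, hj]; exact hxy
      refine ⟨j, ((p i).mapLe hK).append (Walk.cons hadj ((q j).mapLe hK)), ?_, ?_,
        Or.inr ⟨hix, hj⟩⟩
      · refine Walk.IsPath.append_of_inter (by simpa using hp i) ?_ ?_
        · rw [Walk.cons_isPath_iff]
          refine ⟨by simpa using hq j, ?_⟩
          rw [Walk.support_mapLe_eq_support]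
          exact hne _ (p i).end_mem_support
        · intro z hz hz'
          rw [Walk.support_mapLe_eq_support] at hz
          rw [Walk.support_cons, List.mem_cons, Walk.support_mapLe_eq_support] at hz'
          exact hz'.elim id (fun h => (hne z hz h).elim)
      · intro z hz
        rw [Walk.mem_support_append_iff, Walk.support_cons, List.mem_cons,
          Walk.support_mapLe_eq_support, Walk.support_mapLe_eq_support] at hz
        rcases hz with hz | rfl | hz
        · exact Or.inl hz
        · exact Or.inl (p i).end_mem_support
        · exact Or.inr hz
  choose j r hr hrs hj using hglue
  have hcross : ∀ i i' z, z ∈ (p i).support → z ∈ (q (j i')).support → i = i' := by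
    intro i i' z h1 h2
    have hz := hpq i _ z h1 h2
    have e1 := hpX i z h1 hz
    have e2 := hqX _ z h2 hz
    rcases hj i' with ⟨-, h⟩ | ⟨-, h⟩
    · exact he_inj (by rw [← e1, e2, h])
    · exact absurd (h ▸ e2 ▸ hz) hy
  refine ⟨a, fun i => b (j i), r, ha, fun i => hb _, hr, ?_⟩
  intro i i' z hz hz'
  rcases hrs i z hz with h1 | h1 <;> rcases hrs i' z hz' with h2 | h2
  · exact hpd i i' z h1 h2
  · exact hcross i i' z h1 h2
  · exact (hcross i' i z h2 h1).symm
  · have hjj := hqd _ _ z h1 h2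
    have hss : s (j i) = s (j i') := by rw [hjj]
    rcases hj i with ⟨hi, h⟩ | ⟨hi, h⟩ <;> rcases hj i' with ⟨hi', h'⟩ | ⟨hi', h'⟩
    · exact he_inj (by rw [← h, ← h', hss])
    · exact absurd (h' ▸ hss ▸ h ▸ hi) hy
    · exact absurd (h ▸ hss ▸ h' ▸ hi' : y ∈ X) hy
    · exact he_inj (by rw [hi, hi'])

/-- **Menger's theorem**. -/
theorem menger [Finite V] (H : SimpleGraph V) (A B : Set V) (k : ℕ)
    (hsep : ∀ X : Finset V, H.Separates A B X → k ≤ X.card) : H.Linked A B k := by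
  classical
  induction H using WellFoundedLT.induction generalizing A B k with
  | ind H ih =>
    by_cases hne : ∃ x y, H.Adj x y
    swap
    · push Not at hne
      have hfin : (A ∩ B).Finite := Set.toFinite _
      have hle := hsep hfin.toFinset (by
        intro a ha b hb p
        cases p with
        | nil => exact ⟨a, by simp, by simp [ha, hb]⟩
        | cons h _ => exact absurd h (hne _ _))
      obtain ⟨f⟩ : Nonempty (Fin k ↪ hfin.toFinset) := by
        apply Function.Embedding.nonempty_of_card_le
        simpa using hle
      refine ⟨fun i => f i, fun i => f i, fun i => .nil, ?_, ?_, by simp, ?_⟩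
      · intro i
        have := (f i).2
        simp only [Set.Finite.mem_toFinset] at this
        exact this.1
      · intro i
        have := (f i).2
        simp only [Set.Finite.mem_toFinset] at this
        exact this.2
      · intro i j x hi hj
        simp only [Walk.support_nil, List.mem_singleton] at hi hj
        exact f.injective (Subtype.ext (hi ▸ hj))
    obtain ⟨u, v, huv⟩ := hne
    have hlt : ∀ x y, s(x, y) = s(u, v) → H.deleteEdges {s(x, y)} < H := by
      intro x y h
      rw [h]
      refine lt_of_le_of_ne (deleteEdges_le _) ?_
      intro heq
      have := huv
      rw [← heq, deleteEdges_adj] at this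
      exact this.2 rfl
    by_cases hall : ∀ X : Finset V, (H.deleteEdges {s(u, v)}).Separates A B X → k ≤ X.card
    · exact (ih _ (hlt u v rfl) A B k hall).mono (deleteEdges_le _)
    push Not at hall
    obtain ⟨X, hX, hXk⟩ := hall
    have hnot : ¬ H.Separates A B X := fun h => absurd (hsep X h) (by lia)
    obtain ⟨x, y, hxy, hx, hy, hyX⟩ : ∃ x y, s(x, y) = s(u, v) ∧
        x ∈ (H.deleteEdges {s(u, v)}).reachAvoiding A X ∧
        y ∉ (H.deleteEdges {s(u, v)}).reachAvoiding A X ∧ y ∉ X := by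
      unfold Separates at hnot
      push Not at hnot
      obtain ⟨a, ha, b, hb, p, hp⟩ := hnot
      obtain ⟨d, hd, hf, hs⟩ := p.exists_boundary_dart
        ((H.deleteEdges {s(u, v)}).reachAvoiding A X)
        (mem_reachAvoiding_self ha (hp a p.start_mem_support)) (hX.notMem_reachAvoiding hb)
      have hsX := hp _ (p.dart_snd_mem_support_of_mem_darts hd)
      refine ⟨d.fst, d.snd, ?_, hf, hs, hsX⟩
      by_contra he
      exact hs (mem_reachAvoiding_of_adj hf (by rw [deleteEdges_adj]; exact ⟨d.adj, he⟩) hsX)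
    have hlt' := hlt x y hxy
    have hadj : H.Adj x y := by
      have : s(x, y) ∈ H.edgeSet := by rw [hxy]; exact huv
      exact this
    rw [← hxy] at hX hx hy
    have hxX := notMem_of_mem_reachAvoiding hx
    have hsep1 : ∀ Y : Finset V, (H.deleteEdges {s(x, y)}).Separates A (insert x (X : Set V)) Y →
        k ≤ Y.card := fun Y hY => hsep Y (hX.of_deleteEdges_left hy hY)
    have hsep2 : ∀ Y : Finset V, (H.deleteEdges {s(x, y)}).Separates (insert y (X : Set V)) B Y →
        k ≤ Y.card := by
      intro Y hY
      refine hsep Y (Separates.symm ?_)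
      rw [Sym2.eq_swap] at hX hx hy hY
      exact hX.symm.of_deleteEdges_left (hX.disjoint_reachAvoiding hx) hY.symm
    have hk : X.card + 1 = k := by
      have := hsep1 (insert x X) (fun a ha b hb p => ⟨b, p.end_mem_support, by simpa using hb⟩)
      rw [Finset.card_insert_of_notMem (by simpa using hxX)] at this
      lia
    subst hk
    exact Linked.glue (deleteEdges_le _) hadj (by simpa using hxX) (by simpa using hyX) hX
      (ih _ hlt' _ _ _ hsep1) (ih _ hlt' _ _ _ hsep2)

/-- Any two non-isolated vertices remain connected after deleting at most one other vertex. -/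
def Biconnected (S : SimpleGraph V) : Prop :=
  ∀ Z : Set V, Z.Subsingleton → ∀ x ∈ S.support, x ∉ Z → ∀ y ∈ S.support, y ∉ Z →
    ∃ p : S.Walk x y, ∀ a ∈ p.support, a ∉ Z

/-- `P` is an ear of `S`: a path between distinct vertices of `S` that is otherwise disjoint
from `S`. -/
structure IsEar (S : SimpleGraph V) {K : SimpleGraph V} {u w : V} (P : K.Walk u w) : Prop where
  isPath : P.IsPath
  ne : u ≠ w
  left_mem : u ∈ S.support
  right_mem : w ∈ S.support
  inter : ∀ x ∈ P.support, x ∈ S.support → x = u ∨ x = w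
  edges : ∀ e ∈ P.edges, e ∉ S.edgeSet

lemma IsEar.reverse {S K : SimpleGraph V} {u w : V} {P : K.Walk u w} (h : S.IsEar P) :
    S.IsEar P.reverse where
  isPath := h.isPath.reverse
  ne := h.ne.symm
  left_mem := h.right_mem
  right_mem := h.left_mem
  inter x hx hS := (h.inter x (by simpa using hx) hS).symm
  edges e he := h.edges e (by simpa using he)

lemma support_mem_of_walk {S : SimpleGraph V} {x y a : V} (p : S.Walk x y) (hx : x ∈ S.support)
    (ha : a ∈ p.support) : a ∈ S.support := by
  induction p with
  | nil => simpa using (by simpa using ha : a = _) ▸ hx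
  | cons h p ih =>
    rw [Walk.support_cons, List.mem_cons] at ha
    rcases ha with rfl | ha
    · exact hx
    · exact ih h.right_mem_support ha

lemma Walk.edges_ne_nil_of_ne {K : SimpleGraph V} {u w : V} (P : K.Walk u w) (h : u ≠ w) :
    P.edges ≠ [] := by
  cases P with
  | nil => exact absurd rfl h
  | cons h p => simp

lemma Biconnected.sup_ear {S S' : SimpleGraph V} (hS : S.Biconnected) (hle : S ≤ S') {u w : V}
    {P : S'.Walk u w} (hP : S.IsEar P) (hS' : ∀ e ∈ S'.edgeSet, e ∈ S.edgeSet ∨ e ∈ P.edges) :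
    S'.Biconnected := by
  intro Z hZ
  have key : ∀ x ∈ S'.support, x ∉ Z → ∃ x' ∈ S.support, x' ∉ Z ∧
      ∃ p : S'.Walk x x', ∀ a ∈ p.support, a ∉ Z := by
    intro x hx hxZ
    obtain ⟨y, hxy⟩ := hx
    rcases hS' s(x, y) hxy with h | h
    · exact ⟨x, ⟨y, h⟩, hxZ, .nil, by simpa using hxZ⟩
    · have hxP := P.fst_mem_support_of_mem_edges h
      obtain ⟨p1, p2, hp1, hp2, hpe⟩ := hP.isPath.mem_support_iff_exists_append.mp hxP
      by_cases h1 : ∀ a ∈ p1.support, a ∉ Z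
      · exact ⟨u, hP.left_mem, h1 u p1.start_mem_support, p1.reverse, by simpa using h1⟩
      · push Not at h1
        obtain ⟨z, hz1, hzZ⟩ := h1
        have h2 : ∀ a ∈ p2.support, a ∉ Z := by
          intro a ha haZ
          obtain rfl := hZ hzZ haZ
          exact Walk.IsPath.ne_of_mem_support_of_append
            (by rw [← hpe]; exact hP.isPath : (p1.append p2).IsPath)
            (by rintro rfl; exact hxZ hzZ) hz1 ha rfl
        exact ⟨w, hP.right_mem, h2 w p2.end_mem_support, p2, h2⟩
  intro x hx hxZ y hy hyZ
  obtain ⟨x', hx', hx'Z, p, hp⟩ := key x hx hxZ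
  obtain ⟨y', hy', hy'Z, q, hq⟩ := key y hy hyZ
  obtain ⟨r, hr⟩ := hS Z hZ x' hx' hx'Z y' hy' hy'Z
  refine ⟨(p.append (r.mapLe hle)).append q.reverse, ?_⟩
  intro a ha
  rw [Walk.mem_support_append_iff, Walk.mem_support_append_iff, Walk.support_mapLe_eq_support,
    Walk.support_reverse, List.mem_reverse] at ha
  rcases ha with (ha | ha) | ha
  · exact hp a ha
  · exact hr a ha
  · exact hq a ha

lemma biconnected_edge (s t : V) : (edge s t).Biconnected := by
  intro Z hZ x hx hxZ y hy hyZ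
  by_cases hxy : x = y
  · subst hxy
    exact ⟨.nil, by simpa using hxZ⟩
  · have hadj : (edge s t).Adj x y := by
      obtain ⟨x', hx'⟩ := hx
      obtain ⟨y', hy'⟩ := hy
      change (edge s t).Adj x x' at hx'
      change (edge s t).Adj y y' at hy'
      rw [edge_adj] at *
      grind
    exact ⟨.cons hadj .nil, by simp [hxZ, hyZ]⟩

lemma Biconnected.exists_ear {S H : SimpleGraph V} (hH : H.Biconnected) (hle : S ≤ H)
    (hne : S ≠ H) (hS : S.support.Nonempty) :
    ∃ (u w : V) (P : H.Walk u w), S.IsEar P := by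
  by_cases hsupp : ∀ x y, H.Adj x y → x ∈ S.support
  · obtain ⟨a, b, hab, hnab⟩ : ∃ a b, H.Adj a b ∧ ¬ S.Adj a b := by
      by_contra! h
      exact hne (le_antisymm hle h)
    exact ⟨a, b, .cons hab .nil, by simpa using hab.ne, hab.ne, hsupp a b hab,
      hsupp b a hab.symm, by simp, by simpa using hnab⟩
  · push Not at hsupp
    obtain ⟨a, b, hab, ha⟩ := hsupp
    obtain ⟨s0, hs0⟩ := hS
    obtain ⟨p, -⟩ := hH ∅ Set.subsingleton_empty s0 (support_mono hle hs0) (by simp)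
      a hab.left_mem_support (by simp)
    obtain ⟨⟨⟨s, x⟩, hsx⟩, -, hs, hx⟩ := p.exists_boundary_dart S.support hs0 ha
    simp only at hs hx hsx
    obtain ⟨t, hst⟩ := hs
    change S.Adj s t at hst
    obtain ⟨q, hq⟩ := hH {s} Set.subsingleton_singleton x hsx.right_mem_support
      (by simpa using hsx.ne') t (hle hst).right_mem_support (by simpa using hst.ne')
    obtain ⟨w, hw, r, hr, hrq, hrS⟩ := q.exists_isPath_first_mem S.support hst.right_mem_support
    have hsr : s ∉ r.support := fun h => hq s (hrq h) rfl
    refine ⟨s, w, .cons hsx r, ?_, ?_, hst.left_mem_support, hw, ?_, ?_⟩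
    · rw [Walk.cons_isPath_iff]
      exact ⟨hr, hsr⟩
    · rintro rfl
      exact hsr r.end_mem_support
    · intro z hz hzS
      rw [Walk.support_cons, List.mem_cons] at hz
      rcases hz with rfl | hz
      · exact Or.inl rfl
      · exact Or.inr (hrS z hz hzS)
    · intro e he heS
      rw [Walk.edges_cons, List.mem_cons] at he
      rcases he with rfl | he
      · exact hx (mem_edgeSet _ |>.mp heS).right_mem_support
      · induction e with
        | _ c d =>
          have h1 := hrS c (r.fst_mem_support_of_mem_edges he)
            (mem_edgeSet _ |>.mp heS).left_mem_support
          have h2 := hrS d (r.snd_mem_support_of_mem_edges he)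
            (mem_edgeSet _ |>.mp heS).right_mem_support
          exact (mem_edgeSet _ |>.mp heS).ne (h1.trans h2.symm)

/-- Induction along an ear decomposition of a biconnected graph starting from a given edge. -/
theorem Biconnected.ear_induction [Finite V] {H : SimpleGraph V} (hH : H.Biconnected) {s t : V}
    (hst : H.Adj s t) (motive : SimpleGraph V → Prop) (base : motive (edge s t))
    (step : ∀ S S' : SimpleGraph V, S ≤ S' → S.Biconnected → S.Adj s t → motive S →
      ∀ (u w : V) (P : S'.Walk u w), S.IsEar P →
        (∀ e ∈ S'.edgeSet, e ∈ S.edgeSet ∨ e ∈ P.edges) → motive S') : motive H := by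
  have hst' : (edge s t).Adj s t := by
    rw [edge_adj]
    exact ⟨Or.inl ⟨rfl, rfl⟩, hst.ne⟩
  obtain ⟨S, hS⟩ := (Set.toFinite {S | S ≤ H ∧ S.Biconnected ∧ S.Adj s t ∧ motive S}).exists_maximal
    ⟨edge s t, by
      intro x y hxy
      rw [edge_adj] at hxy
      rcases hxy with ⟨⟨rfl, rfl⟩ | ⟨rfl, rfl⟩, -⟩
      · exact hst
      · exact hst.symm, biconnected_edge s t, hst', base⟩
  obtain ⟨⟨hle, hbi, hadj, hmot⟩, hmax⟩ := hS
  by_cases hne : S = H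
  · exact hne ▸ hmot
  obtain ⟨u, w, P, hP⟩ := hH.exists_ear hle hne ⟨s, hadj.left_mem_support⟩
  exfalso
  let S' := S ⊔ fromEdgeSet P.edgeSet
  have hSS' : S ≤ S' := le_sup_left
  have hPS' : ∀ e ∈ P.edges, e ∈ S'.edgeSet := by
    intro e he
    have := P.edges_subset_edgeSet he
    simp only [S', edgeSet_sup, edgeSet_fromEdgeSet]
    exact Or.inr ⟨he, H.not_isDiag_of_mem_edgeSet this⟩
  have hS'H : S' ≤ H := by
    refine sup_le hle ?_
    rw [← edgeSet_subset_edgeSet, edgeSet_fromEdgeSet]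
    exact fun e he => P.edges_subset_edgeSet he.1
  have hS'e : ∀ e ∈ S'.edgeSet, e ∈ S.edgeSet ∨ e ∈ (P.transfer S' hPS').edges := by
    intro e he
    simp only [S', edgeSet_sup, edgeSet_fromEdgeSet] at he
    rw [Walk.edges_transfer]
    exact he.imp id (fun h => h.1)
  have hP' : S.IsEar (P.transfer S' hPS') :=
    ⟨hP.isPath.transfer _, hP.ne, hP.left_mem, hP.right_mem,
      by simpa using hP.inter, by simpa using hP.edges⟩
  have hle' := hmax (y := S') ⟨hS'H, hbi.sup_ear hSS' hP' hS'e, hSS' hadj,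
    step S S' hSS' hbi hadj hmot u w _ hP' hS'e⟩ hSS'
  obtain ⟨e, he⟩ := List.exists_mem_of_ne_nil _ (P.edges_ne_nil_of_ne hP.ne)
  exact hP.edges e he (edgeSet_subset_edgeSet.mpr hle' (hPS' e he))

/-- The edge sets of paths from `s` to `t`. -/
def pathEdgeSets (H : SimpleGraph V) (s t : V) : Set (Set (Sym2 V)) :=
  {F | ∃ p : H.Walk s t, p.IsPath ∧ F = p.edgeSet}

/-- The edge sets of cycles. -/
def cycleEdgeSets (H : SimpleGraph V) : Set (Set (Sym2 V)) :=
  {F | ∃ (u : V) (p : H.Walk u u), p.IsCycle ∧ F = p.edgeSet}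

lemma pathEdgeSets_mono {S S' : SimpleGraph V} (h : S ≤ S') (s t : V) :
    S.pathEdgeSets s t ⊆ S'.pathEdgeSets s t := by
  rintro F ⟨p, hp, rfl⟩
  exact ⟨p.mapLe h, by simpa using hp, by simp⟩

lemma cycleEdgeSets_mono {S S' : SimpleGraph V} (h : S ≤ S') :
    S.cycleEdgeSets ⊆ S'.cycleEdgeSets := by
  rintro F ⟨u, p, hp, rfl⟩
  exact ⟨u, p.mapLe h, by simpa using hp, by simp⟩

lemma Walk.edgeSet_subset {H : SimpleGraph V} {u v : V} (p : H.Walk u v) :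
    p.edgeSet ⊆ H.edgeSet :=
  fun _ he => p.edges_subset_edgeSet he

section ear

variable {S S' : SimpleGraph V} {u w : V} {P : S'.Walk u w}

lemma IsEar.ncard_edgeSet_le [Finite V] (hS' : ∀ e ∈ S'.edgeSet, e ∈ S.edgeSet ∨ e ∈ P.edges) :
    S'.edgeSet.ncard ≤ S.edgeSet.ncard + P.length := by
  classical
  have h1 : S'.edgeSet ⊆ S.edgeSet ∪ (P.edges.toFinset : Set (Sym2 V)) := by
    intro e he
    simpa using hS' e he
  calc S'.edgeSet.ncard ≤ (S.edgeSet ∪ (P.edges.toFinset : Set (Sym2 V))).ncard :=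
        Set.ncard_le_ncard h1 (Set.toFinite _)
    _ ≤ S.edgeSet.ncard + (P.edges.toFinset : Set (Sym2 V)).ncard := Set.ncard_union_le _ _
    _ ≤ S.edgeSet.ncard + P.length := by
        rw [Set.ncard_coe_finset, ← P.length_edges]
        exact Nat.add_le_add_left (List.toFinset_card_le _) _

lemma IsEar.le_ncard_support [Finite V] (hP : S.IsEar P) (hle : S ≤ S') :
    S.support.ncard + P.length ≤ S'.support.ncard + 1 := by
  classical
  have h1 : S.support ∪ (P.support.toFinset : Set V) ⊆ S'.support := by
    rintro x (hx | hx)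
    · exact support_mono hle hx
    · exact support_mem_of_walk P (support_mono hle hP.left_mem) (by simpa using hx)
  have h2 : S.support ∩ (P.support.toFinset : Set V) ⊆ {u, w} := by
    rintro x ⟨hx, hx'⟩
    simpa using hP.inter x (by simpa using hx') hx
  have h3 := Set.ncard_union_add_ncard_inter S.support (P.support.toFinset : Set V)
    (Set.toFinite _) (Set.toFinite _)
  have h4 : (P.support.toFinset : Set V).ncard = P.length + 1 := by
    rw [Set.ncard_coe_finset, List.toFinset_card_of_nodup hP.isPath.support_nodup,
      P.length_support]
  have h5 := Set.ncard_le_ncard h1 (Set.toFinite _)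
  have h6 := (Set.ncard_le_ncard h2 (Set.toFinite _)).trans (Set.ncard_insert_le u {w})
  rw [Set.ncard_singleton] at h6
  lia

lemma IsEar.isPath_append_append (hP : S.IsEar P) (hle : S ≤ S') {s t : V} {p : S.Walk s u}
    {q : S.Walk w t} (hs : s ∈ S.support) (hp : p.IsPath) (hq : q.IsPath)
    (hpq : ∀ x ∈ p.support, x ∉ q.support) :
    (((p.mapLe hle).append P).append (q.mapLe hle)).IsPath := by
  have hpS : ∀ x ∈ p.support, x ∈ S.support := fun x => support_mem_of_walk p hs
  have hqS : ∀ x ∈ q.support, x ∈ S.support := fun x => support_mem_of_walk q hP.right_mem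
  refine Walk.IsPath.append_of_inter (Walk.IsPath.append_of_inter (by simpa using hp) hP.isPath ?_)
    (by simpa using hq) ?_
  · intro a ha haP
    rw [Walk.support_mapLe_eq_support] at ha
    refine (hP.inter a haP (hpS a ha)).resolve_right ?_
    rintro rfl
    exact hpq _ ha q.start_mem_support
  · intro a ha haq
    rw [Walk.mem_support_append_iff, Walk.support_mapLe_eq_support] at ha
    rw [Walk.support_mapLe_eq_support] at haq
    rcases ha with ha | ha
    · exact absurd haq (hpq a ha)
    · refine (hP.inter a ha (hqS a haq)).resolve_left ?_
      rintro rfl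
      exact hpq _ p.end_mem_support haq

lemma IsEar.exists_path_of_linked (hP : S.IsEar P) (hle : S ≤ S') {s t : V} {p : S.Walk s u}
    {q : S.Walk w t} (hs : s ∈ S.support) (hp : p.IsPath) (hq : q.IsPath)
    (hpq : ∀ x ∈ p.support, x ∉ q.support) :
    ∃ F ∈ S'.pathEdgeSets s t, F ∉ S.pathEdgeSets s t := by
  refine ⟨_, ⟨_, hP.isPath_append_append hle hs hp hq hpq, rfl⟩, ?_⟩
  rintro ⟨r, -, hr⟩
  obtain ⟨e, he⟩ := List.exists_mem_of_ne_nil _ (P.edges_ne_nil_of_ne hP.ne)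
  refine hP.edges e he (r.edgeSet_subset ?_)
  rw [← hr, Walk.mem_edgeSet, Walk.edges_append, Walk.edges_append]
  simp [he]

lemma IsEar.exists_new_path [Finite V] (hP : S.IsEar P) (hle : S ≤ S') (hS : S.Biconnected)
    {s t : V} (hst : s ≠ t) (hs : s ∈ S.support) (ht : t ∈ S.support) :
    ∃ F ∈ S'.pathEdgeSets s t, F ∉ S.pathEdgeSets s t := by
  have hL : S.Linked {s, t} {u, w} 2 := by
    refine menger _ _ _ _ ?_
    intro X hX
    by_contra! hlt
    have hX1 : (X : Set V).Subsingleton := by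
      intro a ha b hb
      exact Finset.card_le_one.mp (by lia) a ha b hb
    have h1 : ∃ a ∈ ({s, t} : Set V), a ∈ S.support ∧ a ∉ (X : Set V) := by
      by_cases h : s ∈ (X : Set V)
      · exact ⟨t, by simp, ht, fun h' => hst (hX1 h h')⟩
      · exact ⟨s, by simp, hs, h⟩
    have h2 : ∃ a ∈ ({u, w} : Set V), a ∈ S.support ∧ a ∉ (X : Set V) := by
      by_cases h : u ∈ (X : Set V)
      · exact ⟨w, by simp, hP.right_mem, fun h' => hP.ne (hX1 h h')⟩
      · exact ⟨u, by simp, hP.left_mem, h⟩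
    obtain ⟨a, ha, haS, haX⟩ := h1
    obtain ⟨b, hb, hbS, hbX⟩ := h2
    obtain ⟨p, hp⟩ := hS X hX1 a haS haX b hbS hbX
    obtain ⟨x, hx, hxX⟩ := hX a ha b hb p
    exact hp x hx hxX
  obtain ⟨a, b, p, ha, hb, hp, hd⟩ := hL
  have hab : a 0 ≠ a 1 := fun h => absurd
    (hd 0 1 (a 0) (p 0).start_mem_support (by rw [h]; exact (p 1).start_mem_support)) (by simp)
  have hbb : b 0 ≠ b 1 := fun h => absurd
    (hd 0 1 (b 0) (p 0).end_mem_support (by rw [h]; exact (p 1).end_mem_support)) (by simp)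
  obtain ⟨i, j, hij, hi, hj⟩ : ∃ i j : Fin 2, i ≠ j ∧ a i = s ∧ a j = t := by
    have h0 := ha 0
    have h1 := ha 1
    simp only [Set.mem_insert_iff, Set.mem_singleton_iff] at h0 h1
    rcases h0 with h0 | h0 <;> rcases h1 with h1 | h1
    · exact absurd (h0.trans h1.symm) hab
    · exact ⟨0, 1, by simp, h0, h1⟩
    · exact ⟨1, 0, by simp, h1, h0⟩
    · exact absurd (h0.trans h1.symm) hab
  have hbij : b i ≠ b j := by
    intro h
    fin_cases i <;> fin_cases j <;> simp_all
  have hdisj : ∀ x ∈ (p i).support, x ∉ (p j).support := fun x h1 h2 => hij (hd i j x h1 h2)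
  have hbi := hb i
  have hbj := hb j
  have hpi := hp i
  have hpj := hp j
  generalize p i = pi at *
  generalize p j = pj at *
  generalize b i = bi at *
  generalize b j = bj at *
  generalize a i = ai at *
  generalize a j = aj at *
  subst hi hj
  simp only [Set.mem_insert_iff, Set.mem_singleton_iff] at hbi hbj
  rcases hbi with rfl | rfl
  · obtain rfl : bj = w := hbj.resolve_left (Ne.symm hbij)
    exact hP.exists_path_of_linked hle hs hpi hpj.reverse (by simpa using hdisj)
  · obtain rfl : bj = u := hbj.resolve_right (Ne.symm hbij)
    exact hP.reverse.exists_path_of_linked hle hs hpi hpj.reverse (by simpa using hdisj)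

lemma IsEar.isCycle_append (hP : S.IsEar P) (hle : S ≤ S') {p : S.Walk w u} (hp : p.IsPath) :
    (P.append (p.mapLe hle)).IsCycle := by
  have hpS : ∀ x ∈ p.support, x ∈ S.support := fun x => support_mem_of_walk p hP.right_mem
  refine Walk.IsPath.isCycle_append hP.isPath (by simpa using hp) ?_ ?_
  · intro a ha hb
    rw [Walk.support_mapLe_eq_support] at hb
    have h1 := hP.isPath.support_nodup
    rw [← Walk.cons_tail_support, List.nodup_cons] at h1
    have h2 := hp.support_nodup
    rw [← Walk.cons_tail_support, List.nodup_cons] at h2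
    rcases hP.inter a (List.mem_of_mem_tail ha) (hpS a (List.mem_of_mem_tail hb)) with rfl | rfl
    · exact h1.1 ha
    · exact h2.1 hb
  · by_contra! hlen
    rw [Walk.length_mapLe] at hlen
    have h1 := P.edges_ne_nil_of_ne hP.ne
    have hne := hP.ne
    have hed := hP.edges
    clear hpS hP
    cases P with
    | nil => exact hne rfl
    | cons h P =>
      cases P with
      | cons h' P => simp at hlen
      | nil =>
        cases p with
        | nil => exact hne rfl
        | cons h' p =>
          cases p with
          | cons h'' p => simp at hlen
          | nil => exact hed s(u, w) (by simp) h'.symm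

lemma IsEar.ncard_cycleEdgeSets [Finite V] (hP : S.IsEar P) (hle : S ≤ S') :
    S.cycleEdgeSets.ncard + (S.pathEdgeSets w u).ncard ≤ S'.cycleEdgeSets.ncard := by
  obtain ⟨e, he⟩ := List.exists_mem_of_ne_nil _ (P.edges_ne_nil_of_ne hP.ne)
  have hinj : Set.InjOn (fun F => P.edgeSet ∪ F) (S.pathEdgeSets w u) := by
    have key : ∀ F ∈ S.pathEdgeSets w u, F = (P.edgeSet ∪ F) \ P.edgeSet := by
      rintro F ⟨p, -, rfl⟩
      ext e
      have : e ∈ p.edgeSet → e ∉ P.edgeSet := fun h1 h2 => hP.edges e h2 (p.edgeSet_subset h1)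
      simp only [Set.mem_sdiff, Set.mem_union]
      tauto
    intro F hF F' hF' h
    rw [key F hF, key F' hF']
    exact congrArg (· \ P.edgeSet) h
  rw [← hinj.ncard_image, ← Set.ncard_union_eq ?_ (Set.toFinite _) (Set.toFinite _)]
  · refine Set.ncard_le_ncard (Set.union_subset (cycleEdgeSets_mono hle) ?_) (Set.toFinite _)
    rintro _ ⟨_, ⟨p, hp, rfl⟩, rfl⟩
    refine ⟨_, _, hP.isCycle_append hle hp, ?_⟩
    ext; simp
  · rw [Set.disjoint_left]
    rintro _ ⟨v, c, hc, rfl⟩ ⟨F, -, hF⟩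
    exact hP.edges e he (c.edgeSet_subset (hF ▸ Or.inl he))

end ear

lemma ncard_edgeSet_edge_le (s t : V) : (edge s t).edgeSet.ncard ≤ 1 := by
  rw [edge, edgeSet_fromEdgeSet]
  exact (Set.ncard_le_ncard Set.sdiff_subset).trans (Set.ncard_singleton _).le

lemma two_le_ncard_support [Finite V] {H : SimpleGraph V} {s t : V} (h : H.Adj s t) :
    2 ≤ H.support.ncard := by
  rw [← Set.ncard_pair h.ne]
  exact Set.ncard_le_ncard (by
    rintro x (rfl | rfl)
    · exact h.left_mem_support
    · exact h.right_mem_support) (Set.toFinite _)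

lemma edge_adj_self {s t : V} (h : s ≠ t) : (edge s t).Adj s t := by
  rw [edge_adj]
  exact ⟨Or.inl ⟨rfl, rfl⟩, h⟩

lemma Biconnected.le_ncard_pathEdgeSets_of_adj [Finite V] {H : SimpleGraph V} (hH : H.Biconnected)
    {s t : V} (hst : H.Adj s t) :
    H.edgeSet.ncard + 2 ≤ H.support.ncard + (H.pathEdgeSets s t).ncard := by
  refine hH.ear_induction hst
    (fun S => S.edgeSet.ncard + 2 ≤ S.support.ncard + (S.pathEdgeSets s t).ncard) ?_ ?_
  · have hadj := edge_adj_self hst.ne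
    have h1 := two_le_ncard_support hadj
    have h2 := ncard_edgeSet_edge_le s t
    have h3 : 0 < ((edge s t).pathEdgeSets s t).ncard := by
      rw [Set.ncard_pos (Set.toFinite _)]
      exact ⟨_, .cons hadj .nil, by simpa using hst.ne, rfl⟩
    lia
  · intro S S' hle hS hadj ih u w P hP hS'
    have h1 := IsEar.ncard_edgeSet_le hS'
    have h2 := hP.le_ncard_support hle
    obtain ⟨F, hF, hF'⟩ := hP.exists_new_path hle hS hst.ne hadj.left_mem_support
      hadj.right_mem_support
    have h3 : (S.pathEdgeSets s t).ncard < (S'.pathEdgeSets s t).ncard :=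
      Set.ncard_lt_ncard ⟨pathEdgeSets_mono hle s t, fun h => hF' (h hF)⟩ (Set.toFinite _)
    lia

lemma Biconnected.sup_edge {H : SimpleGraph V} (hH : H.Biconnected) {s t : V} (hst : s ≠ t)
    (hs : s ∈ H.support) (ht : t ∈ H.support) (hadj : ¬ H.Adj s t) :
    (H ⊔ edge s t).Biconnected := by
  have h : (H ⊔ edge s t).Adj s t := Or.inr (edge_adj_self hst)
  refine hH.sup_ear le_sup_left (P := .cons h .nil)
    ⟨by simpa using hst, hst, hs, ht, by simp, by simpa using hadj⟩ ?_
  intro e he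
  rw [edgeSet_sup, edge, edgeSet_fromEdgeSet] at he
  exact he.imp id (fun h => by simpa using h.1)

/-- A biconnected graph of cyclomatic number `c` has at least `c + 1` paths between any two
of its vertices. -/
lemma Biconnected.le_ncard_pathEdgeSets [Finite V] {H : SimpleGraph V} (hH : H.Biconnected)
    {s t : V} (hst : s ≠ t) (hs : s ∈ H.support) (ht : t ∈ H.support) :
    H.edgeSet.ncard + 2 ≤ H.support.ncard + (H.pathEdgeSets s t).ncard := by
  by_cases hadj : H.Adj s t
  · exact hH.le_ncard_pathEdgeSets_of_adj hadj
  have h := (hH.sup_edge hst hs ht hadj).le_ncard_pathEdgeSets_of_adj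
    (Or.inr (edge_adj_self hst))
  have hes : (H ⊔ edge s t).edgeSet = insert s(s, t) H.edgeSet := by
    ext e
    simp only [edgeSet_sup, edge, edgeSet_fromEdgeSet, Set.mem_union, Set.mem_insert_iff,
      Set.mem_sdiff, Set.mem_singleton_iff]
    constructor
    · tauto
    · rintro (rfl | h)
      · exact Or.inr ⟨rfl, by simpa using hst⟩
      · exact Or.inl h
  have h1 : (H ⊔ edge s t).edgeSet.ncard = H.edgeSet.ncard + 1 := by
    rw [hes, Set.ncard_insert_of_notMem (by simpa using hadj) (Set.toFinite _)]
  have h2 : (H ⊔ edge s t).support ⊆ H.support := by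
    rintro x ⟨y, hxy | hxy⟩
    · exact ⟨y, hxy⟩
    · rw [edge_adj] at hxy
      rcases hxy.1 with h | h
      · exact h.1 ▸ hs
      · exact h.1 ▸ ht
  have h3 : (H ⊔ edge s t).pathEdgeSets s t ⊆ insert {s(s, t)} (H.pathEdgeSets s t) := by
    rintro F ⟨p, hp, rfl⟩
    by_cases he : s(s, t) ∈ p.edges
    · left
      cases p with
      | nil => exact absurd rfl hst
      | @cons _ x _ h p =>
        rw [Walk.cons_isPath_iff] at hp
        rw [Walk.edges_cons, List.mem_cons] at he
        rcases he with he | he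
        · obtain rfl : t = x := Sym2.congr_right.mp he
          rw [(Walk.isPath_iff_nil.mp hp.1).eq_nil]
          ext e; simp
        · exact absurd (p.fst_mem_support_of_mem_edges he) hp.2
    · right
      refine ⟨p.transfer H ?_, hp.transfer _, (Walk.edgeSet_transfer _ _).symm⟩
      intro e hep
      have := p.edges_subset_edgeSet hep
      rw [hes] at this
      exact this.resolve_left (by rintro rfl; exact he hep)
  have h4 := (Set.ncard_le_ncard h3 (Set.toFinite _)).trans (Set.ncard_insert_le _ _)
  have h5 := Set.ncard_le_ncard h2 (Set.toFinite _)
  lia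

/-- A biconnected graph of cyclomatic number `c` has at least `binom (c + 1) 2` cycles. -/
theorem Biconnected.choose_le_ncard_cycleEdgeSets [Finite V] {H : SimpleGraph V}
    (hH : H.Biconnected) {s t : V} (hst : H.Adj s t) :
    (H.edgeSet.ncard + 2 - H.support.ncard).choose 2 ≤ H.cycleEdgeSets.ncard := by
  refine hH.ear_induction hst
    (fun S => (S.edgeSet.ncard + 2 - S.support.ncard).choose 2 ≤ S.cycleEdgeSets.ncard) ?_ ?_
  · have h1 := two_le_ncard_support (edge_adj_self hst.ne)
    have h2 := ncard_edgeSet_edge_le s t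
    rw [Nat.choose_eq_zero_of_lt (by lia)]
    exact Nat.zero_le _
  · intro S S' hle hS hadj ih u w P hP hS'
    have h1 := IsEar.ncard_edgeSet_le hS'
    have h2 := hP.le_ncard_support hle
    have h3 := hS.le_ncard_pathEdgeSets hP.ne.symm hP.right_mem hP.left_mem
    have h4 := hP.ncard_cycleEdgeSets hle
    calc (S'.edgeSet.ncard + 2 - S'.support.ncard).choose 2
        ≤ (S.edgeSet.ncard + 2 - S.support.ncard + 1).choose 2 :=
          Nat.choose_le_choose 2 (by lia)
      _ = (S.edgeSet.ncard + 2 - S.support.ncard) +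
          (S.edgeSet.ncard + 2 - S.support.ncard).choose 2 := by
          rw [Nat.choose_succ_succ' _ 1, Nat.choose_one_right]
      _ ≤ S'.cycleEdgeSets.ncard := by lia

end SimpleGraph

lemma SimpleGraph.Walk.exists_walk_support_subset {G : SimpleGraph V} {s : Set V} {x y : s}
    (p : (G.induce s).Walk x y) : ∃ q : G.Walk (x : V) y, ∀ a ∈ q.support, a ∈ s := by
  induction p with
  | @nil u => exact ⟨.nil, by simp⟩
  | @cons u w _ h _ ih =>
    obtain ⟨q, hq⟩ := ih
    have h' : G.Adj (u : V) (w : V) := h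
    refine ⟨.cons h' q, fun a ha => ?_⟩
    rw [Walk.support_cons, List.mem_cons] at ha
    rcases ha with rfl | ha
    · exact u.2
    · exact hq a ha

lemma IsKConnected.exists_walk_avoiding [Fintype V] {k : ℕ} {G : SimpleGraph V}
    (hG : IsKConnected k G) {S : Finset V} (hS : S.card < k) {x y : V} (hx : x ∉ S) (hy : y ∉ S) :
    ∃ p : G.Walk x y, ∀ a ∈ p.support, a ∉ S := by
  obtain ⟨p⟩ := (hG.2 S hS).preconnected ⟨x, by simpa using hx⟩ ⟨y, by simpa using hy⟩
  obtain ⟨q, hq⟩ := p.exists_walk_support_subset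
  exact ⟨q, fun a ha => by simpa using hq a ha⟩

namespace SimpleGraph

lemma Walk.length_pos_of_ne {G : SimpleGraph V} {u w : V} (p : G.Walk u w) (h : u ≠ w) :
    0 < p.length := by
  cases p with
  | nil => exact absurd rfl h
  | cons h p => simp

/-- Three disjoint paths from neighbours of `v` to `C`, avoiding `v` and meeting `C` only in
their last vertices. -/
structure Fan (G : SimpleGraph V) (v : V) (C : Set V) where
  start : Fin 3 → V
  last : Fin 3 → V
  path : ∀ i, G.Walk (start i) (last i)
  adj : ∀ i, G.Adj v (start i)
  isPath : ∀ i, (path i).IsPath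
  notMem : ∀ i, v ∉ (path i).support
  disjoint : ∀ i j x, x ∈ (path i).support → x ∈ (path j).support → i = j
  last_mem : ∀ i, last i ∈ C
  eq_last : ∀ i, ∀ a ∈ (path i).support, a ∈ C → a = last i

lemma linked_delete_two_edges [Fintype V] {G : SimpleGraph V} (hG : IsKConnected 3 G) {v x y : V}
    (hx : G.Adj v x) (hy : G.Adj v y) (hxy : x ≠ y) {C : Finset V} (hC : 3 ≤ C.card) :
    (G.deleteEdges {s(v, x), s(v, y)}).Linked {x, y, v} C 3 := by
  classical
  have htrans : ∀ {a b : V} (p : G.Walk a b), v ∉ p.support →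
      ∀ e ∈ p.edges, e ∈ (G.deleteEdges {s(v, x), s(v, y)}).edgeSet := by
    intro a b p hv e he
    rw [edgeSet_deleteEdges]
    refine ⟨p.edges_subset_edgeSet he, ?_⟩
    rintro (rfl | rfl) <;> exact hv (p.fst_mem_support_of_mem_edges he)
  refine menger _ _ _ _ ?_
  intro X hX
  by_contra! hlt
  obtain ⟨c, hc, hcX⟩ := Finset.exists_mem_notMem_of_card_lt_card (hlt.trans_le hC)
  by_cases hvX : v ∈ X
  · obtain ⟨w, hw, hwX⟩ : ∃ w ∈ ({x, y, v} : Set V), w ∉ X := by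
      by_contra! h
      have hsub : ({x, y, v} : Finset V) ⊆ X := by
        intro w hw
        exact h w (by simpa using hw)
      have := Finset.card_le_card hsub
      rw [Finset.card_eq_three.mpr ⟨x, y, v, hxy, hx.ne', hy.ne', rfl⟩] at this
      lia
    obtain ⟨p, hp⟩ := hG.exists_walk_avoiding hlt hwX hcX
    have hvp : v ∉ p.support := fun h => hp v h hvX
    obtain ⟨z, hz, hzX⟩ := hX w hw c hc (p.transfer _ (htrans p hvp))
    exact hp z (by simpa using hz) hzX
  · obtain ⟨p, hp⟩ := hG.exists_walk_avoiding hlt hvX hcX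
    have hp' : ∀ a ∈ p.bypass.support, a ∉ X := fun a ha =>
      hp a (p.support_bypass_subset_support ha)
    have hpp := p.bypass_isPath
    generalize p.bypass = r at hp' hpp
    cases r with
    | nil =>
      obtain ⟨z, hz, hzX⟩ := hX v (by simp) v hc .nil
      exact hp' z (by simpa using hz) hzX
    | @cons _ w _ h r =>
      rw [Walk.cons_isPath_iff] at hpp
      by_cases hw : w = x ∨ w = y
      · obtain ⟨z, hz, hzX⟩ := hX w (by simp; tauto) c hc (r.transfer _ (htrans r hpp.2))
        exact hp' z (by simp at hz; simp [hz]) hzX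
      · have hadj : (G.deleteEdges {s(v, x), s(v, y)}).Adj v w := by
          rw [deleteEdges_adj]
          refine ⟨h, ?_⟩
          rintro (he | he)
          · exact hw (Or.inl (Sym2.congr_right.mp he))
          · exact hw (Or.inr (Sym2.congr_right.mp he))
        obtain ⟨z, hz, hzX⟩ := hX v (by simp) c hc (.cons hadj (r.transfer _ (htrans r hpp.2)))
        exact hp' z (by simpa using hz) hzX

/-- In a 3-connected graph any two edges at `v` extend to a fan from `v` to `C`. -/
theorem exists_fan [Fintype V] {G : SimpleGraph V} (hG : IsKConnected 3 G) {v x y : V}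
    (hx : G.Adj v x) (hy : G.Adj v y) (hxy : x ≠ y) {C : Finset V} (hC : 3 ≤ C.card)
    (hv : v ∉ C) : ∃ f : G.Fan v C, x ∈ Set.range f.start ∧ y ∈ Set.range f.start := by
  classical
  obtain ⟨a, b, p, ha, hb, -, hd⟩ :=
    (linked_delete_two_edges hG hx hy hxy hC).mono (deleteEdges_le _)
  have ha_inj : Function.Injective a := fun i j hij =>
    hd i j (a i) (p i).start_mem_support (by rw [hij]; exact (p j).start_mem_support)
  have ha_surj : ∀ w ∈ ({x, y, v} : Finset V), ∃ i, a i = w := by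
    have := Finset.eq_of_subset_of_card_le (s := Finset.univ.image a) (t := {x, y, v})
      (by intro u hu; simp only [Finset.mem_image, Finset.mem_univ, true_and] at hu
          obtain ⟨i, rfl⟩ := hu; simpa using ha i)
      (by rw [Finset.card_image_of_injective _ ha_inj]; exact Finset.card_le_three)
    intro w hw
    rw [← this] at hw
    simpa using hw
  have key : ∀ i, ∃ (z t : V) (q : G.Walk z t), G.Adj v z ∧ q.IsPath ∧ v ∉ q.support ∧
      q.support ⊆ (p i).support ∧ t ∈ C ∧ (∀ u ∈ q.support, u ∈ C → u = t) ∧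
      (a i ≠ v → z = a i) := by
    intro i
    obtain ⟨t, ht, q, hq, hqp, hqC⟩ := (p i).exists_isPath_first_mem (C : Set V) (hb i)
    by_cases hi : a i = v
    · obtain ⟨L, hL⟩ : ∃ L, L = (p i).support := ⟨_, rfl⟩
      rw [← hL] at hqp ⊢
      clear hL
      generalize a i = ai at q hi hq hqp hqC ⊢
      subst hi
      cases q with
      | nil => exact absurd ht hv
      | @cons _ z _ h q =>
        rw [Walk.cons_isPath_iff] at hq
        rw [Walk.support_cons, List.cons_subset] at hqp
        refine ⟨z, t, q, h, hq.1, hq.2, hqp.2, ht, ?_, fun h => absurd rfl h⟩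
        intro u hu
        exact hqC u (by simp [hu])
    · refine ⟨a i, t, q, ?_, hq, ?_, hqp, ht, hqC, fun _ => rfl⟩
      · have := ha i
        simp only [Set.mem_insert_iff, Set.mem_singleton_iff, hi, or_false] at this
        rcases this with h | h <;> rw [h] <;> assumption
      · intro hvq
        obtain ⟨j, hj⟩ := ha_surj v (by simp)
        have := hd i j v (hqp hvq) (by rw [← hj]; exact (p j).start_mem_support)
        exact hi (this ▸ hj)
  choose z t q hadj hq hvq hqp ht hqC hz using key
  refine ⟨⟨z, t, q, hadj, hq, hvq, fun i j x hi hj => hd i j x (hqp i hi) (hqp j hj), ht, hqC⟩,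
    ?_, ?_⟩
  · obtain ⟨i, hi⟩ := ha_surj x (by simp)
    exact ⟨i, (hz i (by rw [hi]; exact hx.ne')).trans hi⟩
  · obtain ⟨i, hi⟩ := ha_surj y (by simp)
    exact ⟨i, (hz i (by rw [hi]; exact hy.ne')).trans hi⟩

lemma Walk.IsCycle.exists_three_paths_aux {G : SimpleGraph V} {t₀ t₁ t₂ : V} (c₁ : G.Walk t₀ t₁)
    (c₂ : G.Walk t₁ t₀) (hc : (c₁.append c₂).IsCycle) (h₀₁ : t₀ ≠ t₁) (h₀₂ : t₀ ≠ t₂)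
    (h₁₂ : t₁ ≠ t₂) (ht : t₂ ∈ c₂.support) :
    ∃ (p : G.Walk t₀ t₁) (q : G.Walk t₀ t₂) (r : G.Walk t₁ t₂),
      p.IsPath ∧ q.IsPath ∧ r.IsPath ∧
      (∀ x, x ∈ p.support → x ∈ q.support → x = t₀) ∧
      (∀ x, x ∈ p.support → x ∈ r.support → x = t₁) ∧
      (∀ x, x ∈ q.support → x ∈ r.support → x = t₂) ∧
      (∀ e, e ∈ (c₁.append c₂).edges ↔ e ∈ p.edges ∨ e ∈ q.edges ∨ e ∈ r.edges) := by
  obtain ⟨c₃, c₄, rfl⟩ := Walk.mem_support_iff_exists_append.mp ht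
  have hn := hc.support_nodup
  rw [Walk.tail_support_append, Walk.tail_support_append, List.nodup_append, List.nodup_append]
    at hn
  obtain ⟨n1, ⟨n3, n4, n34⟩, n134⟩ := hn
  have e1 : t₁ ∈ c₁.support.tail := c₁.end_mem_tail_support (fun h => h₀₁ h.eq)
  have e3 : t₂ ∈ c₃.support.tail := c₃.end_mem_tail_support (fun h => h₁₂ h.eq)
  have e4 : t₀ ∈ c₄.support.tail := c₄.end_mem_tail_support (fun h => h₀₂ h.eq.symm)
  have m1 : ∀ x, x ∈ c₁.support ↔ x = t₀ ∨ x ∈ c₁.support.tail := fun x => c₁.mem_support_iff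
  have m3 : ∀ x, x ∈ c₃.support ↔ x = t₁ ∨ x ∈ c₃.support.tail := fun x => c₃.mem_support_iff
  have m4 : ∀ x, x ∈ c₄.support ↔ x = t₂ ∨ x ∈ c₄.support.tail := fun x => c₄.mem_support_iff
  have s1 : c₁.IsPath := by
    rw [Walk.isPath_def, ← Walk.cons_tail_support, List.nodup_cons]
    grind
  have s3 : c₃.IsPath := by
    rw [Walk.isPath_def, ← Walk.cons_tail_support, List.nodup_cons]
    grind
  have s4 : c₄.IsPath := by
    rw [Walk.isPath_def, ← Walk.cons_tail_support, List.nodup_cons]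
    grind
  refine ⟨c₁, c₄.reverse, c₃, s1, s4.reverse, s3, ?_, ?_, ?_, ?_⟩
  · intro x hx hy
    rw [Walk.support_reverse, List.mem_reverse] at hy
    grind
  · intro x hx hy
    grind
  · intro x hx hy
    rw [Walk.support_reverse, List.mem_reverse] at hx
    grind
  · intro e
    simp only [Walk.edges_append, Walk.edges_reverse, List.mem_append, List.mem_reverse]
    tauto

/-- Three vertices of a cycle cut it into three paths. -/
lemma Walk.IsCycle.exists_three_paths {G : SimpleGraph V} {r t₀ t₁ t₂ : V} {c : G.Walk r r}
    (hc : c.IsCycle) (h₀₁ : t₀ ≠ t₁) (h₀₂ : t₀ ≠ t₂) (h₁₂ : t₁ ≠ t₂) (ht₀ : t₀ ∈ c.support)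
    (ht₁ : t₁ ∈ c.support) (ht₂ : t₂ ∈ c.support) :
    ∃ (p : G.Walk t₀ t₁) (q : G.Walk t₀ t₂) (r : G.Walk t₁ t₂),
      p.IsPath ∧ q.IsPath ∧ r.IsPath ∧
      (∀ x, x ∈ p.support → x ∈ q.support → x = t₀) ∧
      (∀ x, x ∈ p.support → x ∈ r.support → x = t₁) ∧
      (∀ x, x ∈ q.support → x ∈ r.support → x = t₂) ∧
      (∀ e, e ∈ c.edges ↔ e ∈ p.edges ∨ e ∈ q.edges ∨ e ∈ r.edges) := by
  classical
  have hc' := hc.rotate ht₀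
  have he : ∀ e, e ∈ (c.rotate t₀ ht₀).edges ↔ e ∈ c.edges := fun e =>
    (c.rotate_edges t₀ ht₀).perm.mem_iff
  have ht₁' := (c.mem_support_rotate_iff t₀ ht₀).mpr ht₁
  have ht₂' := (c.mem_support_rotate_iff t₀ ht₀).mpr ht₂
  simp only [← he]
  generalize c.rotate t₀ ht₀ = d at hc' ht₁' ht₂'
  obtain ⟨c₁, c₂, rfl⟩ := Walk.mem_support_iff_exists_append.mp ht₁'
  rw [Walk.mem_support_append_iff] at ht₂'
  rcases ht₂' with h | h
  · obtain ⟨p, q, r, hp, hq, hr, h1, h2, h3, h4⟩ :=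
      Walk.IsCycle.exists_three_paths_aux c₂.reverse c₁.reverse
        (by rw [← Walk.reverse_append]; exact hc'.reverse) h₀₁ h₀₂ h₁₂ (by simpa using h)
    refine ⟨p, q, r, hp, hq, hr, h1, h2, h3, fun e => ?_⟩
    rw [← h4 e, ← Walk.reverse_append, Walk.edges_reverse, List.mem_reverse]
  · exact Walk.IsCycle.exists_three_paths_aux c₁ c₂ hc' h₀₁ h₀₂ h₁₂ h

/-- Two distinct edges of `K₄` share the branch vertices in which their subdividing paths meet. -/
lemma mem_inter_branch (x v t₀ t₁ t₂ : V) {a₀ a₁ a₂ p q s : Set V}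
    (a01 : x ∈ a₀ → x ∈ a₁ → x = v) (a02 : x ∈ a₀ → x ∈ a₂ → x = v)
    (a12 : x ∈ a₁ → x ∈ a₂ → x = v)
    (p0 : x ∈ a₀ → x ∈ p → x = t₀) (p1 : x ∈ a₁ → x ∈ p → x = t₁) (p2 : x ∈ a₂ → x ∉ p)
    (q0 : x ∈ a₀ → x ∈ q → x = t₀) (q1 : x ∈ a₁ → x ∉ q) (q2 : x ∈ a₂ → x ∈ q → x = t₂)
    (s0 : x ∈ a₀ → x ∉ s) (s1 : x ∈ a₁ → x ∈ s → x = t₁) (s2 : x ∈ a₂ → x ∈ s → x = t₂)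
    (pq : x ∈ p → x ∈ q → x = t₀) (ps : x ∈ p → x ∈ s → x = t₁) (qs : x ∈ q → x ∈ s → x = t₂)
    (i j k l : Fin 4) (hij : i < j) (hkl : k < l) (hne : (i, j) ≠ (k, l))
    (hx : x ∈ (![![∅, a₀, a₁, a₂], ![∅, ∅, p, q], ![∅, ∅, ∅, s], ![∅, ∅, ∅, ∅]] :
      Fin 4 → Fin 4 → Set V) i j)
    (hx' : x ∈ (![![∅, a₀, a₁, a₂], ![∅, ∅, p, q], ![∅, ∅, ∅, s], ![∅, ∅, ∅, ∅]] :
      Fin 4 → Fin 4 → Set V) k l) :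
    x ∈ ({![v, t₀, t₁, t₂] i, ![v, t₀, t₁, t₂] j} ∩
      {![v, t₀, t₁, t₂] k, ![v, t₀, t₁, t₂] l} : Set V) := by
  fin_cases i <;> fin_cases j <;> first
    | exact absurd hij (by decide)
    | (fin_cases k <;> fin_cases l <;> first
        | exact absurd hkl (by decide)
        | exact absurd rfl hne
        | (first
           | exact absurd hx' (p2 hx) | exact absurd hx (p2 hx')
           | exact absurd hx' (q1 hx) | exact absurd hx (q1 hx')
           | exact absurd hx' (s0 hx) | exact absurd hx (s0 hx')
           | (first
              | refine (fun e => ?_) (a01 hx hx')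
              | refine (fun e => ?_) (a01 hx' hx)
              | refine (fun e => ?_) (a02 hx hx')
              | refine (fun e => ?_) (a02 hx' hx)
              | refine (fun e => ?_) (a12 hx hx')
              | refine (fun e => ?_) (a12 hx' hx)
              | refine (fun e => ?_) (p0 hx hx')
              | refine (fun e => ?_) (p0 hx' hx)
              | refine (fun e => ?_) (p1 hx hx')
              | refine (fun e => ?_) (p1 hx' hx)
              | refine (fun e => ?_) (q0 hx hx')
              | refine (fun e => ?_) (q0 hx' hx)
              | refine (fun e => ?_) (q2 hx hx')
              | refine (fun e => ?_) (q2 hx' hx)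
              | refine (fun e => ?_) (s1 hx hx')
              | refine (fun e => ?_) (s1 hx' hx)
              | refine (fun e => ?_) (s2 hx hx')
              | refine (fun e => ?_) (s2 hx' hx)
              | refine (fun e => ?_) (pq hx hx')
              | refine (fun e => ?_) (pq hx' hx)
              | refine (fun e => ?_) (ps hx hx')
              | refine (fun e => ?_) (ps hx' hx)
              | refine (fun e => ?_) (qs hx hx')
              | refine (fun e => ?_) (qs hx' hx)
              )
             simp [e]))

/-- A fan from `v` to three vertices of a cycle that misses `v` completes the cycle to a
`K₄`-subdivision. -/
theorem Fan.exists_isK4Subdivision {G : SimpleGraph V} {r v : V} {c : G.Walk r r}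
    (hc : c.IsCycle) {C : Set V} (hC : ∀ a, a ∈ C ↔ a ∈ c.support) (hv : v ∉ C)
    (f : G.Fan v C) :
    ∃ H : G.Subgraph, IsK4Subdivision H ∧ ∀ e, e ∈ H.edgeSet ↔
      e ∈ c.edges ∨ ∃ i, e = s(v, f.start i) ∨ e ∈ (f.path i).edges := by
  have hl : Function.Injective f.last := fun i j hij =>
    f.disjoint i j (f.last i) (Walk.end_mem_support _) (by rw [hij]; exact Walk.end_mem_support _)
  have h₀₁ : f.last 0 ≠ f.last 1 := hl.ne (by decide)
  have h₀₂ : f.last 0 ≠ f.last 2 := hl.ne (by decide)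
  have h₁₂ : f.last 1 ≠ f.last 2 := hl.ne (by decide)
  have hvl : ∀ i, v ≠ f.last i := fun i h => hv (h ▸ f.last_mem i)
  obtain ⟨p, q, s, hp, hq, hs, hpq, hps, hqs, he⟩ := hc.exists_three_paths h₀₁ h₀₂ h₁₂
    ((hC _).mp (f.last_mem 0)) ((hC _).mp (f.last_mem 1)) ((hC _).mp (f.last_mem 2))
  have hsub : ∀ {a b : V} (w : G.Walk a b), a ≠ b → (∀ e ∈ w.edges, e ∈ c.edges) →
      ∀ x ∈ w.support, x ∈ C := by
    intro a b w hab hw x hx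
    obtain ⟨e, he, hxe⟩ := (Walk.mem_support_iff_exists_mem_edges_of_not_nil
      (fun h => hab h.eq)).mp hx
    exact (hC x).mpr (Walk.mem_support_of_mem_edges (hw e he) hxe)
  have hpC := hsub p h₀₁ (fun e h => (he e).mpr (Or.inl h))
  have hqC := hsub q h₀₂ (fun e h => (he e).mpr (Or.inr (Or.inl h)))
  have hsC := hsub s h₁₂ (fun e h => (he e).mpr (Or.inr (Or.inr h)))
  let b : Fin 4 → V := ![v, f.last 0, f.last 1, f.last 2]
  let g : ∀ i, G.Walk v (f.last i) := fun i => .cons (f.adj i) (f.path i)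
  have hg : ∀ i, (g i).IsPath := fun i => (Walk.cons_isPath_iff _ _).mpr ⟨f.isPath i, f.notMem i⟩
  have hgg : ∀ i j, i ≠ j → ∀ x, x ∈ (g i).support → x ∈ (g j).support → x = v := by
    intro i j hij x hi hj
    simp only [g, Walk.support_cons, List.mem_cons] at hi hj
    rcases hi with hi | hi
    · exact hi
    rcases hj with hj | hj
    · exact hj
    exact absurd (f.disjoint i j x hi hj) hij
  have hgC : ∀ i x, x ∈ (g i).support → x ∈ C → x = f.last i := by
    intro i x hi hx
    simp only [g, Walk.support_cons, List.mem_cons] at hi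
    rcases hi with rfl | hi
    · exact absurd hx hv
    · exact f.eq_last i x hi hx
  have hge : ∀ i e, e ∈ (g i).edges ↔ e = s(v, f.start i) ∨ e ∈ (f.path i).edges := by
    intro i e
    simp [g]
  simp only [← hge]
  generalize g = g at hg hgg hgC
  let S : Fin 4 → Fin 4 → Set V := ![
    ![∅, {x | x ∈ (g 0).support}, {x | x ∈ (g 1).support}, {x | x ∈ (g 2).support}],
    ![∅, ∅, {x | x ∈ p.support}, {x | x ∈ q.support}], ![∅, ∅, ∅, {x | x ∈ s.support}],
    ![∅, ∅, ∅, ∅]]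
  let E : Fin 4 → Fin 4 → Set (Sym2 V) := ![
    ![∅, (g 0).edgeSet, (g 1).edgeSet, (g 2).edgeSet],
    ![∅, ∅, p.edgeSet, q.edgeSet], ![∅, ∅, ∅, s.edgeSet], ![∅, ∅, ∅, ∅]]
  have key : ∀ p : Fin 4 × Fin 4, p.1 < p.2 → ∃ w : G.Walk (b p.1) (b p.2), w.IsPath ∧
      (∀ x, x ∈ w.support ↔ x ∈ S p.1 p.2) ∧ w.edgeSet = E p.1 p.2 := by
    rintro ⟨i, j⟩ h
    fin_cases i <;> fin_cases j <;> first
      | exact absurd h (by decide)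
      | exact ⟨g 0, hg 0, fun _ => Iff.rfl, rfl⟩
      | exact ⟨g 1, hg 1, fun _ => Iff.rfl, rfl⟩
      | exact ⟨g 2, hg 2, fun _ => Iff.rfl, rfl⟩
      | exact ⟨p, hp, fun _ => Iff.rfl, rfl⟩
      | exact ⟨q, hq, fun _ => Iff.rfl, rfl⟩
      | exact ⟨s, hs, fun _ => Iff.rfl, rfl⟩
  choose P hP hPS hPE using key
  have hb : Function.Injective b := by
    intro i j hij
    fin_cases i <;> fin_cases j <;> first
      | rfl
      | exact absurd hij (hvl _)
      | exact absurd hij.symm (hvl _)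
      | exact absurd (hl hij) (by decide)
  refine ⟨⨆ (p : Fin 4 × Fin 4) (h : p.1 < p.2), (P p h).toSubgraph,
    ⟨b, hb, P, hP, ?_, rfl, ?_⟩, ?_⟩
  · intro p h
    exact Walk.length_pos_of_ne _ (hb.ne h.ne)
  · have hpg : ∀ i x, x ∈ (g i).support → x ∈ p.support → x = f.last i :=
      fun i x h h' => hgC i x h (hpC x h')
    have hqg : ∀ i x, x ∈ (g i).support → x ∈ q.support → x = f.last i :=
      fun i x h h' => hgC i x h (hqC x h')
    have hsg : ∀ i x, x ∈ (g i).support → x ∈ s.support → x = f.last i :=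
      fun i x h h' => hgC i x h (hsC x h')
    have h2p : f.last 2 ∉ p.support := fun h => h₀₂ (hpq _ h q.end_mem_support).symm
    have h1q : f.last 1 ∉ q.support := fun h => h₀₁ (hpq _ p.end_mem_support h).symm
    have h0s : f.last 0 ∉ s.support := fun h => h₀₁ (hps _ p.start_mem_support h)
    have h2 : ∀ x, x ∈ (g 2).support → x ∉ p.support := fun x h h' => h2p (hpg 2 x h h' ▸ h')
    have h1 : ∀ x, x ∈ (g 1).support → x ∉ q.support := fun x h h' => h1q (hqg 1 x h h' ▸ h')
    have h0 : ∀ x, x ∈ (g 0).support → x ∉ s.support := fun x h h' => h0s (hsg 0 x h h' ▸ h')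
    rintro ⟨i, j⟩ ⟨k, l⟩ h h' hne x hx hx'
    rw [hPS] at hx hx'
    exact mem_inter_branch x v _ _ _ (hgg 0 1 (by decide) x) (hgg 0 2 (by decide) x)
      (hgg 1 2 (by decide) x) (hpg 0 x) (hpg 1 x) (h2 x)
      (hqg 0 x) (h1 x) (hqg 2 x)
      (h0 x) (hsg 1 x) (hsg 2 x) (hpq x) (hps x) (hqs x)
      i j k l h h' hne hx hx'
  · intro e
    simp only [Subgraph.edgeSet_iSup, Set.mem_iUnion, Walk.edgeSet_toSubgraph]
    have hmem : (∃ p : Fin 4 × Fin 4, ∃ h : p.1 < p.2, e ∈ (P p h).edgeSet) ↔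
        ∃ i j : Fin 4, i < j ∧ e ∈ E i j := by
      constructor
      · rintro ⟨⟨i, j⟩, h, he⟩
        exact ⟨i, j, h, by rwa [hPE] at he⟩
      · rintro ⟨i, j, h, he⟩
        exact ⟨(i, j), h, by rwa [hPE]⟩
    refine Iff.trans hmem ?_
    rw [he]
    simp [E, Fin.exists_fin_succ]
    tauto

lemma Walk.IsCycle.exists_ne_edge {G : SimpleGraph V} {r : V} {c : G.Walk r r} (hc : c.IsCycle)
    {e : Sym2 V} (he : e ∈ c.edges) {u : V} (hu : u ∈ e) :
    ∃ e' ∈ c.edges, e' ≠ e ∧ u ∈ e' := by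
  have h2 := hc.ncard_neighborSet_toSubgraph_eq_two (Walk.mem_support_of_mem_edges he hu)
  obtain ⟨w, rfl⟩ := Sym2.mem_iff_exists.mp hu
  obtain ⟨z, hz, hzw⟩ := Set.exists_ne_of_one_lt_ncard (a := w) (by rw [h2]; norm_num)
  rw [Subgraph.mem_neighborSet, Walk.adj_toSubgraph_iff_mem_edges] at hz
  exact ⟨s(u, z), hz, fun h => hzw (Sym2.congr_right.mp h), Sym2.mem_mk_left _ _⟩

/-- A set of edges without leaves that can meet a path only along the path, except at its last
vertex, does not use the path. -/
lemma Walk.IsPath.notMem_of_no_leaf {G : SimpleGraph V} {x t : V} {q : G.Walk x t} (hq : q.IsPath)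
    {F : Set (Sym2 V)} (hF : ∀ e ∈ F, ∀ u ∈ e, ∃ e' ∈ F, e' ≠ e ∧ u ∈ e')
    (hFq : ∀ u ∈ q.support, u ≠ t → ∀ e ∈ F, u ∈ e → e ∈ q.edges) : ∀ e ∈ q.edges, e ∉ F := by
  induction q with
  | nil => simp
  | @cons x y t h q ih =>
    rw [Walk.cons_isPath_iff] at hq
    have hx : s(x, y) ∉ F := by
      intro hxF
      obtain ⟨e, he, hne, hxe⟩ := hF _ hxF x (Sym2.mem_mk_left _ _)
      have := hFq x (by simp) (fun h => hq.2 (h ▸ q.end_mem_support)) e he hxe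
      rw [Walk.edges_cons, List.mem_cons] at this
      exact hq.2 (Walk.mem_support_of_mem_edges (this.resolve_left hne) hxe)
    intro e he
    rw [Walk.edges_cons, List.mem_cons] at he
    rcases he with rfl | he
    · exact hx
    · refine ih hq.1 (fun u hu hut e he hue => ?_) e he
      have := hFq u (by simp [hu]) hut e he hue
      rw [Walk.edges_cons, List.mem_cons] at this
      exact this.resolve_left (fun h => hx (h ▸ he))

/-- In the `K₄`-subdivision built from a cycle and a fan from `v`, the cycle is the only one
missing `v`. -/
theorem Fan.exists_isK4Subdivision_core {G : SimpleGraph V} {r v : V} {c : G.Walk r r}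
    (hc : c.IsCycle) {C : Set V} (hC : ∀ a, a ∈ C ↔ a ∈ c.support) (hv : v ∉ C)
    (f : G.Fan v C) :
    ∃ H : G.Subgraph, IsK4Subdivision H ∧ H.neighborSet v = Set.range f.start ∧
      c.edgeSet ⊆ H.edgeSet ∧ ∀ F ⊆ H.edgeSet, (∀ e ∈ F, v ∉ e) →
        (∀ e ∈ F, ∀ u ∈ e, ∃ e' ∈ F, e' ≠ e ∧ u ∈ e') → F ⊆ c.edgeSet := by
  obtain ⟨H, hH, he⟩ := f.exists_isK4Subdivision hc hC hv
  refine ⟨H, hH, ?_, fun e h => (he e).mpr (Or.inl h), ?_⟩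
  · ext w
    rw [Subgraph.mem_neighborSet, ← Subgraph.mem_edgeSet, he]
    constructor
    · rintro (h | ⟨i, h | h⟩)
      · exact absurd ((hC v).mpr (Walk.mem_support_of_mem_edges h (Sym2.mem_mk_left _ _))) hv
      · exact ⟨i, (Sym2.congr_right.mp h).symm⟩
      · exact absurd (Walk.mem_support_of_mem_edges h (Sym2.mem_mk_left _ _)) (f.notMem i)
    · rintro ⟨i, rfl⟩
      exact Or.inr ⟨i, Or.inl rfl⟩
  · intro F hFH hvF hF e heF
    have hpath : ∀ i, ∀ e ∈ (f.path i).edges, e ∉ F := by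
      intro i
      refine (f.isPath i).notMem_of_no_leaf hF ?_
      intro u hu hul e heF hue
      rcases (he e).mp (hFH heF) with h | ⟨j, h | h⟩
      · exact absurd (f.eq_last i u hu ((hC u).mpr (Walk.mem_support_of_mem_edges h hue))) hul
      · exact absurd (h ▸ Sym2.mem_mk_left _ _) (hvF e heF)
      · obtain rfl := f.disjoint i j u hu (Walk.mem_support_of_mem_edges h hue)
        exact h
    rcases (he e).mp (hFH heF) with h | ⟨j, h | h⟩
    · exact h
    · exact absurd (h ▸ Sym2.mem_mk_left _ _) (hvF e heF)
    · exact absurd heF (hpath j e h)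

lemma Fan.ncard_range_start {G : SimpleGraph V} {v : V} {C : Set V} (f : G.Fan v C) :
    (Set.range f.start).ncard = 3 := by
  have : Function.Injective f.start := fun i j hij =>
    f.disjoint i j (f.start i) (Walk.start_mem_support _)
      (by rw [hij]; exact Walk.start_mem_support _)
  rw [← Set.image_univ, Set.ncard_image_of_injective _ this, Set.ncard_univ, Nat.card_fin]

lemma Walk.IsPath.ncard_neighborSet_toSubgraph_le_two {G : SimpleGraph V} {x y w : V}
    {p : G.Walk x y} (hp : p.IsPath) (hx : w ≠ x) (hy : w ≠ y) :
    (p.toSubgraph.neighborSet w).ncard ≤ 2 := by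
  by_cases hw : w ∈ p.support
  · obtain ⟨i, rfl, hi⟩ := Walk.mem_support_iff_exists_getVert.mp hw
    refine (hp.ncard_neighborSet_toSubgraph_internal_eq_two ?_ ?_).le
    · rintro rfl
      simp at hx
    · refine lt_of_le_of_ne hi ?_
      rintro rfl
      simp at hy
  · have : p.toSubgraph.neighborSet w = ∅ := by
      ext z
      simp only [Subgraph.mem_neighborSet, Walk.adj_toSubgraph_iff_mem_edges,
        Set.mem_empty_iff_false, iff_false]
      exact fun h => hw (p.fst_mem_support_of_mem_edges h)
    rw [this]
    simp

end SimpleGraph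

lemma IsK4Subdivision.ncard_le_four {G : SimpleGraph V} [Finite V] {H : G.Subgraph}
    (hH : IsK4Subdivision H) : {v | (H.neighborSet v).ncard = 3}.ncard ≤ 4 := by
  obtain ⟨b, hb, P, hP, -, rfl, hPP⟩ := hH
  have hsub : {v | ((⨆ (p : Fin 4 × Fin 4) (h : p.1 < p.2),
      (P p h).toSubgraph).neighborSet v).ncard = 3} ⊆ Set.range b := by
    intro w hw
    by_contra hwb
    have hwb' : ∀ i, w ≠ b i := fun i h => hwb ⟨i, h.symm⟩
    have huniq : ∀ p q hp hq, w ∈ (P p hp).support → w ∈ (P q hq).support → p = q := by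
      intro p q hp hq h h'
      by_contra hne
      have := (hPP p q hp hq hne w h h').1
      simp only [Set.mem_insert_iff, Set.mem_singleton_iff] at this
      rcases this with h | h
      · exact hwb' _ h
      · exact hwb' _ h
    have hadj : ∀ z, (⨆ (p : Fin 4 × Fin 4) (h : p.1 < p.2), (P p h).toSubgraph).Adj w z ↔
        ∃ p h, s(w, z) ∈ (P p h).edges := by
      intro z
      simp only [Subgraph.iSup_adj, Walk.adj_toSubgraph_iff_mem_edges]
    change Set.ncard _ = 3 at hw
    obtain ⟨z, hz⟩ := (Set.nonempty_of_ncard_ne_zero (by rw [hw]; norm_num))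
    obtain ⟨p, h, hp⟩ := (hadj z).mp hz
    have hle := Set.ncard_le_ncard (s := (⨆ (p : Fin 4 × Fin 4) (h : p.1 < p.2),
      (P p h).toSubgraph).neighborSet w) (t := (P p h).toSubgraph.neighborSet w) (by
        intro z hz
        obtain ⟨q, h', hq⟩ := (hadj z).mp hz
        obtain rfl := huniq p q h h' (Walk.fst_mem_support_of_mem_edges _ hp)
          (Walk.fst_mem_support_of_mem_edges _ hq)
        rwa [Subgraph.mem_neighborSet, Walk.adj_toSubgraph_iff_mem_edges])
    have := (hP p h).ncard_neighborSet_toSubgraph_le_two (hwb' _) (hwb' _)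
    lia
  refine (Set.ncard_le_ncard hsub).trans ?_
  rw [← Set.image_univ]
  refine (Set.ncard_image_le).trans ?_
  rw [Set.ncard_univ, Nat.card_fin]

lemma IsKConnected.le_degree [Fintype V] {k : ℕ} {G : SimpleGraph V} [DecidableRel G.Adj]
    (hG : IsKConnected k G) (v : V) : k ≤ G.degree v := by
  classical
  by_contra! h
  have hv : v ∉ G.neighborFinset v := by simp
  obtain ⟨y, hy⟩ : ∃ y, y ∉ insert v (G.neighborFinset v) := by
    by_contra! hall
    have := Finset.card_le_card (fun y _ => hall y : Finset.univ ⊆ insert v (G.neighborFinset v))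
    rw [Finset.card_insert_of_notMem hv, Finset.card_univ, G.card_neighborFinset_eq_degree] at this
    have := hG.1
    lia
  rw [Finset.mem_insert, not_or] at hy
  obtain ⟨p, hp⟩ := hG.exists_walk_avoiding (S := G.neighborFinset v)
    (by rwa [G.card_neighborFinset_eq_degree]) hv hy.2
  cases p with
  | nil => exact hy.1 rfl
  | @cons _ w _ hw p => exact hp w (by simp) (by simpa using hw)

namespace SimpleGraph

lemma notMem_of_mem_edgeSet_deleteIncidenceSet {G : SimpleGraph V} {v : V} {e : Sym2 V}
    (he : e ∈ (G.deleteIncidenceSet v).edgeSet) : v ∉ e := by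
  intro hv
  rw [edgeSet_deleteIncidenceSet] at he
  exact he.2 ⟨he.1, hv⟩

lemma biconnected_deleteIncidenceSet [Fintype V] {G : SimpleGraph V} (hG : IsKConnected 3 G)
    (v : V) : (G.deleteIncidenceSet v).Biconnected := by
  classical
  intro Z hZ x hx hxZ y hy hyZ
  have hxv : x ≠ v := (G.support_deleteIncidenceSet_subset v hx).2
  have hyv : y ≠ v := (G.support_deleteIncidenceSet_subset v hy).2
  have hcard : (insert v Z.toFinset).card < 3 := by
    have h1 := Finset.card_insert_le v Z.toFinset
    have h2 : Z.toFinset.card ≤ 1 := by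
      rw [Finset.card_le_one]
      intro a ha b hb
      exact hZ (by simpa using ha) (by simpa using hb)
    lia
  obtain ⟨p, hp⟩ := hG.exists_walk_avoiding hcard (x := x) (y := y) (by simp [hxv, hxZ])
    (by simp [hyv, hyZ])
  refine ⟨p.transfer _ ?_, ?_⟩
  · intro e he
    rw [edgeSet_deleteIncidenceSet]
    exact ⟨p.edges_subset_edgeSet he, fun h =>
      hp v (Walk.mem_support_of_mem_edges he h.2) (by simp)⟩
  · intro a ha haZ
    exact hp a (by simpa using ha) (by simp [haZ])

lemma choose_le_ncard_cycleEdgeSets_deleteIncidenceSet [Fintype V] {G : SimpleGraph V}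
    [DecidableRel G.Adj] (hG : IsKConnected 3 G) (v : V) :
    (G.edgeSet.ncard - Fintype.card V + 2 - G.degree v + 1).choose 2 ≤
      (G.deleteIncidenceSet v).cycleEdgeSets.ncard := by
  classical
  obtain ⟨s, t, hst⟩ : ∃ s t, (G.deleteIncidenceSet v).Adj s t := by
    have hn := hG.1
    obtain ⟨x, hx, y, hy, hxy⟩ := Finset.one_lt_card.mp (show 1 < (Finset.univ.erase v).card by
      rw [Finset.card_erase_of_mem (Finset.mem_univ v), Finset.card_univ]
      lia)
    obtain ⟨p, hp⟩ := hG.exists_walk_avoiding (S := {v}) (by simp) (x := x) (y := y)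
      (by simpa using hx) (by simpa using hy)
    cases p with
    | nil => exact absurd rfl hxy
    | @cons _ w _ h p =>
      refine ⟨x, w, ?_⟩
      rw [deleteIncidenceSet_adj]
      exact ⟨h, by simpa using hx, by simpa using hp w (by simp)⟩
  refine le_trans ?_ ((biconnected_deleteIncidenceSet hG v).choose_le_ncard_cycleEdgeSets hst)
  have hd := hG.le_degree v
  have hm : G.edgeSet.ncard = G.edgeFinset.card := by
    rw [← coe_edgeFinset, Set.ncard_coe_finset]
  have hm' : (G.deleteIncidenceSet v).edgeSet.ncard = G.edgeSet.ncard - G.degree v := by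
    rw [hm, ← G.card_edgeFinset_deleteIncidenceSet, ← coe_edgeFinset, Set.ncard_coe_finset]
  have hs : (G.deleteIncidenceSet v).support.ncard ≤ Fintype.card V - 1 := by
    refine (Set.ncard_le_ncard (t := {v}ᶜ) ?_ (Set.toFinite _)).trans ?_
    · exact (G.support_deleteIncidenceSet_subset v).trans (fun x hx => hx.2)
    · rw [Set.ncard_compl, Set.ncard_singleton, Nat.card_eq_fintype_card]
  have hdm : G.degree v ≤ G.edgeSet.ncard := by
    rw [hm, ← G.card_incidenceFinset_eq_degree]
    exact Finset.card_le_card (G.incidenceFinset_subset v)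
  have := hG.1
  rw [hm']
  by_cases h : G.edgeSet.ncard - Fintype.card V + 2 ≤ G.degree v
  · rw [Nat.choose_eq_zero_of_lt (by lia)]
    exact Nat.zero_le _
  · exact Nat.choose_le_choose 2 (by lia)

/-- The `K₄`-subdivisions of `G` in which `v` has degree three. -/
def cubicK4Subdivisions (G : SimpleGraph V) (v : V) : Set G.Subgraph :=
  {H | IsK4Subdivision H ∧ (H.neighborSet v).ncard = 3}

/-- The `K₄`-subdivisions of `G` in which `v` has degree three and `C` is the unique cycle
missing `v`. -/
def coreK4Subdivisions (G : SimpleGraph V) (v : V) (C : Set (Sym2 V)) : Set G.Subgraph :=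
  {H | H ∈ G.cubicK4Subdivisions v ∧ C ⊆ H.edgeSet ∧
    ∀ F ∈ (G.deleteIncidenceSet v).cycleEdgeSets, F ⊆ H.edgeSet → F ⊆ C}

lemma exists_mem_coreK4Subdivisions [Fintype V] {G : SimpleGraph V} (hG : IsKConnected 3 G)
    {v : V} {C : Set (Sym2 V)} (hC : C ∈ (G.deleteIncidenceSet v).cycleEdgeSets) {x y : V}
    (hx : G.Adj v x) (hy : G.Adj v y) (hxy : x ≠ y) :
    ∃ H ∈ G.coreK4Subdivisions v C, H.Adj v x ∧ H.Adj v y := by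
  classical
  obtain ⟨r, p, hp, rfl⟩ := hC
  have hvp : v ∉ p.support := by
    intro hv
    obtain ⟨e, he, hve⟩ := (Walk.mem_support_iff_exists_mem_edges_of_not_nil hp.not_nil).mp hv
    exact notMem_of_mem_edgeSet_deleteIncidenceSet (p.edges_subset_edgeSet he) hve
  have hcard : 3 ≤ p.support.toFinset.card := by
    have h1 := hp.three_le_length
    have h2 : p.support.tail.toFinset.card = p.support.tail.length :=
      List.toFinset_card_of_nodup hp.support_nodup
    have h3 : p.support.tail.toFinset ⊆ p.support.toFinset := fun a ha => by
      rw [List.mem_toFinset] at ha ⊢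
      exact List.mem_of_mem_tail ha
    have h4 := Finset.card_le_card h3
    rw [h2, List.length_tail, Walk.length_support] at h4
    lia
  obtain ⟨f, hfx, hfy⟩ := exists_fan hG hx hy hxy hcard (by simpa using hvp)
  obtain ⟨H, hH, hnbr, hsub, hcore⟩ := f.exists_isK4Subdivision_core
    (hp.mapLe (G.deleteIncidenceSet_le v)) (by simp) (by simpa using hvp)
  have hedge : (p.mapLe (G.deleteIncidenceSet_le v)).edgeSet = p.edgeSet := by
    ext e
    simp
  rw [hedge] at hsub hcore
  refine ⟨H, ⟨⟨hH, by rw [hnbr, f.ncard_range_start]⟩, hsub, ?_⟩, ?_, ?_⟩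
  · rintro F ⟨u, q, hq, rfl⟩ hF
    refine hcore _ hF (fun e he => ?_) (fun e he u hu => hq.exists_ne_edge he hu)
    exact notMem_of_mem_edgeSet_deleteIncidenceSet (q.edges_subset_edgeSet he)
  · rwa [← Subgraph.mem_neighborSet, hnbr]
  · rwa [← Subgraph.mem_neighborSet, hnbr]

lemma choose_degree_le [Fintype V] {G : SimpleGraph V} [DecidableRel G.Adj]
    (hG : IsKConnected 3 G) {v : V} {C : Set (Sym2 V)}
    (hC : C ∈ (G.deleteIncidenceSet v).cycleEdgeSets) :
    (G.degree v).choose 2 ≤ (G.coreK4Subdivisions v C).ncard * 3 := by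
  classical
  have hfin : (G.coreK4Subdivisions v C).Finite := Set.toFinite _
  rw [Set.ncard_eq_toFinset_card _ hfin, ← G.card_neighborFinset_eq_degree,
    ← Finset.card_powersetCard]
  refine le_trans (Finset.card_le_card ?_) (Finset.card_biUnion_le_card_mul hfin.toFinset
    (fun H => (H.neighborSet v).toFinset.powersetCard 2) 3 ?_)
  · intro s hs
    rw [Finset.mem_powersetCard, Finset.card_eq_two] at hs
    obtain ⟨hs, x, y, hxy, rfl⟩ := hs
    simp only [Finset.insert_subset_iff, Finset.singleton_subset_iff, mem_neighborFinset] at hs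
    obtain ⟨H, hH, hx, hy⟩ := exists_mem_coreK4Subdivisions hG hC hs.1 hs.2 hxy
    rw [Finset.mem_biUnion]
    refine ⟨H, by simpa using hH, ?_⟩
    rw [Finset.mem_powersetCard, Finset.card_pair hxy]
    simp [Set.insert_subset_iff, hx, hy]
  · intro H hH
    rw [Set.Finite.mem_toFinset] at hH
    rw [Finset.card_powersetCard, ← Set.ncard_eq_toFinset_card', hH.1.2]
    decide

lemma mul_le_ncard_cubicK4Subdivisions [Fintype V] {G : SimpleGraph V} [DecidableRel G.Adj]
    (hG : IsKConnected 3 G) (v : V) :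
    ((G.degree v).choose 2 + 2) / 3 * (G.deleteIncidenceSet v).cycleEdgeSets.ncard ≤
      (G.cubicK4Subdivisions v).ncard := by
  classical
  have hfin : (G.deleteIncidenceSet v).cycleEdgeSets.Finite := Set.toFinite _
  have hfin' : ∀ C, (G.coreK4Subdivisions v C).Finite := fun _ => Set.toFinite _
  have hfin'' : (G.cubicK4Subdivisions v).Finite := Set.toFinite _
  rw [Set.ncard_eq_toFinset_card _ hfin, Set.ncard_eq_toFinset_card _ hfin'', mul_comm]
  refine le_trans ?_ (Finset.card_le_card (s := hfin.toFinset.biUnion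
    fun C => (hfin' C).toFinset) ?_)
  · rw [Finset.card_biUnion]
    · rw [← smul_eq_mul]
      refine Finset.card_nsmul_le_sum _ _ _ (fun C hC => ?_)
      rw [Set.Finite.mem_toFinset] at hC
      have := choose_degree_le hG hC
      rw [← Set.ncard_eq_toFinset_card]
      lia
    · intro C hC D hD hCD
      rw [Function.onFun, Finset.disjoint_left]
      intro H hH hH'
      simp only [Finset.mem_coe, Set.Finite.mem_toFinset] at hC hD hH hH'
      exact hCD ((hH'.2.2 C hC hH.2.1).antisymm (hH.2.2 D hD hH'.2.1))
  · intro H hH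
    simp only [Finset.mem_biUnion, Set.Finite.mem_toFinset] at hH ⊢
    obtain ⟨C, -, hH⟩ := hH
    exact hH.1

lemma sum_ncard_cubicK4Subdivisions_le [Fintype V] (G : SimpleGraph V) :
    ∑ v, (G.cubicK4Subdivisions v).ncard ≤ {H : G.Subgraph | IsK4Subdivision H}.ncard * 4 := by
  classical
  have hfin : {H : G.Subgraph | IsK4Subdivision H}.Finite := Set.toFinite _
  have h1 : ∀ v, (G.cubicK4Subdivisions v).ncard =
      (hfin.toFinset.bipartiteAbove (fun v H => (H.neighborSet v).ncard = 3) v).card := by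
    intro v
    rw [← Set.ncard_coe_finset]
    congr 1
    ext H
    simp [cubicK4Subdivisions, Finset.bipartiteAbove]
  simp only [h1]
  rw [Finset.sum_card_bipartiteAbove_eq_sum_card_bipartiteBelow, Set.ncard_eq_toFinset_card _ hfin,
    ← smul_eq_mul]
  refine Finset.sum_le_card_nsmul _ _ _ (fun H hH => ?_)
  rw [Set.Finite.mem_toFinset] at hH
  refine le_trans (le_of_eq ?_) (IsK4Subdivision.ncard_le_four hH)
  rw [← Set.ncard_coe_finset]
  congr 1
  ext v
  simp [Finset.bipartiteBelow]

end SimpleGraph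

/-- Let `G` be a 3-connected graph with `n` vertices, `m` edges and
vertex degrees `d v`, and set `a := m - n + 2`. Then `G` contains at least
`(1/4) ∑_v ⌈(1/3) binom(d v, 2)⌉ binom(a - d v + 1, 2)` distinct `K₄`-subdivisions
(here `⌈x/3⌉` is written as the natural number `(x + 2) / 3`). -/
theorem stmt13 [Fintype V] {G : SimpleGraph V} [DecidableRel G.Adj]
    (hG : IsKConnected 3 G) :
    (1 / 4 : ℝ) * ∑ v : V,
        ((((G.degree v).choose 2 + 2) / 3 : ℕ) : ℝ) *
          (((G.edgeSet.ncard - Fintype.card V + 2 - G.degree v + 1).choose 2 : ℕ) : ℝ) ≤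
      ({H : G.Subgraph | IsK4Subdivision H}.ncard : ℝ) := by
  have hsum : ∑ v : V, ((G.degree v).choose 2 + 2) / 3 *
      (G.edgeSet.ncard - Fintype.card V + 2 - G.degree v + 1).choose 2 ≤
      {H : G.Subgraph | IsK4Subdivision H}.ncard * 4 :=
    (Finset.sum_le_sum fun v _ => (Nat.mul_le_mul_left _
      (choose_le_ncard_cycleEdgeSets_deleteIncidenceSet hG v)).trans
        (mul_le_ncard_cubicK4Subdivisions hG v)).trans (sum_ncard_cubicK4Subdivisions_le G)
  have hreal : (∑ v : V, ((((G.degree v).choose 2 + 2) / 3 : ℕ) : ℝ) *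
      (((G.edgeSet.ncard - Fintype.card V + 2 - G.degree v + 1).choose 2 : ℕ) : ℝ)) ≤
      ({H : G.Subgraph | IsK4Subdivision H}.ncard : ℝ) * 4 := by
    exact_mod_cast hsum
  linarith
end
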